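/- Let u : τ → σ be a morphism of Ω_n^epi of degree d ≥ 2, and let E = T_0. In the poset E/Ω_n^epi, ordered by α ≥ β if and only if there exists a (necessarily unique) morphism α → β, the order complex of the open interval between α = (τ, id_{T_0}) and β = (σ, u_0) — the simplicial complex whose simplices are the chains of objects strictly between β and α — has reduced homology with coefficients in the commutative ring k equal to k in dimension d − 2 and 0 in all other dimensions. In particular the intervals of the poset E/Ω_n^epi are Cohen–Macaulay over k. -/

import Mathlib

open CategoryTheory

/-- An object of the category `Ω_n^epi` of pruned `n`-level trees: a sequence of
monotone surjections `T_0 → T_1 → ⋯ → T_n` between the finite ordered sets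
`T_i = Fin (t i)`, with `T_n` (and all higher levels) a one-point set. -/
structure PTree (n : ℕ) where
  t : ℕ → ℕ
  map : ∀ i : ℕ, Fin (t i) → Fin (t (i+1))
  mono : ∀ i, Monotone (map i)
  surjmap : ∀ i, Function.Surjective (map i)
  top : ∀ i, n ≤ i → t i = 1

/-- A morphism of pruned trees: a family of surjections commuting with the
structure maps, order-preserving on every fiber of the structure maps. -/
structure PTreeHom {n : ℕ} (τ σ : PTree n) where
  app : ∀ i, Fin (τ.t i) → Fin (σ.t i)
  surj : ∀ i, Function.Surjective (app i)
  comm : ∀ i x, app (i+1) (τ.map i x) = σ.map i (app i x)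
  fiberMono : ∀ i x y, τ.map i x = τ.map i y → x ≤ y → app i x ≤ app i y

theorem PTreeHom.ext' {n : ℕ} {τ σ : PTree n} {f g : PTreeHom τ σ}
    (h : f.app = g.app) : f = g := by
  cases f; cases g; cases h; rfl

instance (n : ℕ) : Category (PTree n) where
  Hom := PTreeHom
  id τ := ⟨fun _ => _root_.id, fun _ => Function.surjective_id, fun _ _ => rfl,
    fun _ _ _ _ h => h⟩
  comp f g :=
    ⟨fun i => g.app i ∘ f.app i,
     fun i => (g.surj i).comp (f.surj i),
     fun i x => by simp only [Function.comp_apply, f.comm, g.comm],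
     fun i x y hxy hle =>
       g.fiberMono i _ _ (by rw [← f.comm, ← f.comm, hxy]) (f.fiberMono i x y hxy hle)⟩
  id_comp _ := PTreeHom.ext' rfl
  comp_id _ := PTreeHom.ext' rfl
  assoc _ _ _ := PTreeHom.ext' rfl

/-- The degree of a pruned tree: the number of vertices of levels `0,…,n-1`. -/
def PTree.deg {n : ℕ} (τ : PTree n) : ℕ := ∑ i ∈ Finset.range n, τ.t i

/-- The degree of a morphism `u : τ ⟶ σ`: `deg τ - deg σ`. -/
def homDeg {n : ℕ} {τ σ : PTree n} (_ : τ ⟶ σ) : ℤ :=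
  (τ.deg : ℤ) - (σ.deg : ℤ)

/-- A morphism (with possibly different source and target) is an identity. -/
def IsIdentityHom {n : ℕ} {τ σ : PTree n} (u : τ ⟶ σ) : Prop :=
  ∃ h : τ = σ, u = eqToHom h

open scoped Classical

/-- The objects of the open interval `(β, α)` in the poset `E/Ω_n^epi`
(for `E = T_0`, `α = (τ, id)`, `β = (σ, u_0)`): they correspond to the
factorizations `u = v ∘ w` with `v` and `w` non-identities. -/
def IntObj {n : ℕ} {τ σ : PTree n} (u : τ ⟶ σ) : Type :=
  {p : Σ θ : PTree n, (τ ⟶ θ) × (θ ⟶ σ) //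
    p.2.1 ≫ p.2.2 = u ∧ ¬ IsIdentityHom p.2.1 ∧ ¬ IsIdentityHom p.2.2}

/-- The (strict) order relation of the interval: `x > y` iff there is a
(necessarily unique) morphism from `x` to `y` in the comma category and
`x ≠ y`.  (Here `IntRel x y` denotes `x > y`.) -/
def IntRel {n : ℕ} {τ σ : PTree n} {u : τ ⟶ σ} (x y : IntObj u) : Prop :=
  (∃ z : x.1.1 ⟶ y.1.1, x.1.2.1 ≫ z = y.1.2.1) ∧ x ≠ y

/-- The `m`-simplices of the order complex of the open interval: the strictly
decreasing `(m+1)`-chains of objects of the interval. -/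
def IntSimp {n : ℕ} {τ σ : PTree n} (u : τ ⟶ σ) (m : ℕ) : Type :=
  {s : Fin (m + 1) → IntObj u //
    ∀ i j : Fin (m + 1), i < j → IntRel (s i) (s j)}

/-- The simplicial boundary of a basis simplex. -/
noncomputable def intBFun {n : ℕ} {τ σ : PTree n} {u : τ ⟶ σ}
    (k : Type) [CommRing k] {m : ℕ} (s : IntSimp u (m + 1)) :
    IntSimp u m →₀ k :=
  ∑ i : Fin (m + 2),
    ((-1 : k) ^ (i : ℕ)) •
      Finsupp.single (⟨s.1 ∘ i.succAbove, by
        intro a b hab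
        exact s.2 _ _ (by simpa using Fin.strictMono_succAbove i hab)⟩ :
        IntSimp u m) 1

/-- The boundary operator of the order complex (with coefficients in `k`). -/
noncomputable def intBdry {n : ℕ} {τ σ : PTree n} {u : τ ⟶ σ}
    (k : Type) [CommRing k] {m : ℕ} (x : IntSimp u (m + 1) →₀ k) :
    IntSimp u m →₀ k :=
  x.sum fun s a => a • intBFun k s

/-- The augmentation of the order complex. -/
noncomputable def intAug {n : ℕ} {τ σ : PTree n} {u : τ ⟶ σ}
    (k : Type) [CommRing k] (x : IntSimp u 0 →₀ k) : k :=
  x.sum fun _ a => a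

/-- Reduced cycles: in dimension 0, the kernel of the augmentation; in
dimension `m + 1`, the kernel of the boundary. -/
def intIsCyc {n : ℕ} {τ σ : PTree n} {u : τ ⟶ σ}
    (k : Type) [CommRing k] : ∀ m : ℕ, (IntSimp u m →₀ k) → Prop
  | 0, x => intAug k x = 0
  | _ + 1, x => intBdry k x = 0

namespace OrderHomology

section Boundary

variable {V : Type*} (k : Type*) [CommRing k]

/-- Prepend a vertex to every list of a formal combination of lists. -/
noncomputable def consMap (v : V) : (List V →₀ k) →ₗ[k] (List V →₀ k) :=
  Finsupp.lmapDomain k k (List.cons v)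

@[simp]
theorem consMap_single (v : V) (l : List V) (a : k) :
    consMap k v (Finsupp.single l a) = Finsupp.single (v :: l) a := by
  simp [consMap]

/-- The augmented simplicial boundary of a list of vertices. -/
noncomputable def listBoundary : List V → (List V →₀ k)
  | [] => 0
  | v :: l => Finsupp.single l 1 - consMap k v (listBoundary l)

/-- The augmented simplicial boundary, extended linearly to combinations of lists. -/
noncomputable def boundary : (List V →₀ k) →ₗ[k] (List V →₀ k) :=
  Finsupp.linearCombination k (listBoundary k)

@[simp]
theorem boundary_single (l : List V) (a : k) :
    boundary k (Finsupp.single l a) = a • listBoundary k l := by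
  simp [boundary]

theorem boundary_consMap (v : V) (x : List V →₀ k) :
    boundary k (consMap k v x) = x - consMap k v (boundary k x) := by
  induction x using Finsupp.induction_linear with
  | zero => simp
  | add x y hx hy => simp only [map_add, hx, hy]; abel
  | single l a => simp [listBoundary, smul_sub]

theorem boundary_listBoundary (l : List V) : boundary k (listBoundary k l) = 0 := by
  induction l with
  | nil => simp [listBoundary]
  | cons v l ih => simp [listBoundary, boundary_consMap, ih]

theorem boundary_boundary (x : List V →₀ k) : boundary k (boundary k x) = 0 := by
  induction x using Finsupp.induction_linear with
  | zero => simp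
  | add x y hx hy => simp only [map_add, hx, hy, add_zero]
  | single l a => simp [boundary_listBoundary]

theorem consMap_mem_supported {v : V} {S S' : Set (List V)} (h : ∀ l ∈ S, v :: l ∈ S')
    {x : List V →₀ k} (hx : x ∈ Finsupp.supported k k S) :
    consMap k v x ∈ Finsupp.supported k k S' := by
  rw [Finsupp.supported_eq_span_single] at hx
  induction hx using Submodule.span_induction with
  | mem x hx =>
    obtain ⟨l, hl, rfl⟩ := hx
    simpa using Finsupp.single_mem_supported k (1 : k) (h l hl)
  | zero => simp
  | add x y _ _ hx hy => rw [map_add]; exact add_mem hx hy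
  | smul a x _ hx => rw [map_smul]; exact Submodule.smul_mem _ _ hx

theorem listBoundary_mem_supported (l : List V) :
    listBoundary k l ∈
      Finsupp.supported k k {l' | l'.Sublist l ∧ l'.length + 1 = l.length} := by
  induction l with
  | nil => simp [listBoundary]
  | cons v l ih =>
    refine sub_mem (Finsupp.single_mem_supported k _ ?_) (consMap_mem_supported k ?_ ih)
    · simp
    · rintro l' ⟨h1, h2⟩
      exact ⟨h1.cons_cons v, by simp [h2]⟩

theorem boundary_mem_supported {S S' : Set (List V)}
    (h : ∀ l ∈ S, ∀ l' : List V, l'.Sublist l → l'.length + 1 = l.length → l' ∈ S')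
    {x : List V →₀ k} (hx : x ∈ Finsupp.supported k k S) :
    boundary k x ∈ Finsupp.supported k k S' := by
  rw [Finsupp.supported_eq_span_single] at hx
  induction hx using Submodule.span_induction with
  | mem x hx =>
    obtain ⟨l, hl, rfl⟩ := hx
    rw [boundary_single, one_smul]
    exact Finsupp.supported_mono (fun l' hl' => h l hl l' hl'.1 hl'.2)
      (listBoundary_mem_supported k l)
  | zero => simp
  | add x y _ _ hx hy => rw [map_add]; exact add_mem hx hy
  | smul a x _ hx => rw [map_smul]; exact Submodule.smul_mem _ _ hx

/-- The part of a combination of lists carried by the lists of length `m`. -/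
noncomputable def lengthPart (m : ℕ) (x : List V →₀ k) : List V →₀ k :=
  x.filter fun l => l.length = m

@[simp]
theorem lengthPart_zero (m : ℕ) : lengthPart k m (0 : List V →₀ k) = 0 :=
  (Finsupp.filter_eq_zero_iff _ _).2 fun _ _ => rfl

theorem lengthPart_add (m : ℕ) (x y : List V →₀ k) :
    lengthPart k m (x + y) = lengthPart k m x + lengthPart k m y :=
  Finsupp.filter_add

theorem lengthPart_smul (m : ℕ) (a : k) (x : List V →₀ k) :
    lengthPart k m (a • x) = a • lengthPart k m x :=
  Finsupp.filter_smul

theorem lengthPart_mem {m : ℕ} {S : Set (List V)} {x : List V →₀ k}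
    (hx : x ∈ Finsupp.supported k k S) :
    lengthPart k m x ∈ Finsupp.supported k k (S ∩ {l | l.length = m}) := by
  rw [Finsupp.mem_supported] at hx ⊢
  intro l hl
  simp only [lengthPart, Finsupp.support_filter, Finset.coe_filter, Set.mem_ofPred_eq] at hl
  exact ⟨hx hl.1, hl.2⟩

theorem lengthPart_of_mem {m : ℕ} {x : List V →₀ k}
    (hx : x ∈ Finsupp.supported k k {l : List V | l.length = m}) : lengthPart k m x = x := by
  rw [lengthPart, Finsupp.filter_eq_self_iff]
  intro l hl
  exact hx (Finsupp.mem_support_iff.2 hl)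

theorem lengthPart_of_mem_ne {m m' : ℕ} (hm : m' ≠ m) {x : List V →₀ k}
    (hx : x ∈ Finsupp.supported k k {l : List V | l.length = m'}) : lengthPart k m x = 0 := by
  rw [lengthPart, Finsupp.filter_eq_zero_iff]
  intro l hl
  by_contra h
  exact hm ((hx (Finsupp.mem_support_iff.2 h) : l.length = m').symm.trans hl)

theorem lengthPart_boundary (m : ℕ) (x : List V →₀ k) :
    lengthPart k m (boundary k x) = boundary k (lengthPart k (m + 1) x) := by
  induction x using Finsupp.induction_linear with
  | zero => simp
  | add x y hx hy => simp only [map_add, lengthPart_add, hx, hy]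
  | single l a =>
    have key : ∀ j, l.length = j + 1 → boundary k (Finsupp.single l a) ∈
        Finsupp.supported k k {l : List V | l.length = j} := fun j hj =>
      boundary_mem_supported k (S := {l}) (by rintro _ rfl l' - h; simp; omega)
        (Finsupp.single_mem_supported k a rfl)
    by_cases h : l.length = m + 1
    · rw [lengthPart_of_mem k (key m h), lengthPart_of_mem k]
      exact Finsupp.single_mem_supported k a h
    · rw [lengthPart_of_mem_ne k h (Finsupp.single_mem_supported k a rfl), map_zero]
      cases l with
      | nil => simp [listBoundary]
      | cons v l =>
        exact lengthPart_of_mem_ne k (by simpa using h) (key l.length rfl)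

end Boundary

section Homology

variable {V : Type*} (k : Type*) [CommRing k] (r : V → V → Prop)

/-- The lists of vertices in `A` which are chains for the relation `r`. -/
def chainLists (A : Set V) : Set (List V) := {l | l.Pairwise r ∧ ∀ x ∈ l, x ∈ A}

/-- The augmented chains of the order complex of `A`. -/
noncomputable def chains (A : Set V) : Submodule k (List V →₀ k) :=
  Finsupp.supported k k (chainLists r A)

/-- The reduced homology of the order complex of `A` vanishes. -/
def IsAcyclic (A : Set V) : Prop :=
  ∀ x ∈ chains k r A, boundary k x = 0 → ∃ y ∈ chains k r A, boundary k y = x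

/-- The reduced homology of the order complex of `A` is that of a sphere, the generator being
carried by chains with `m` vertices (so that the sphere has dimension `m - 1`). -/
def IsSpherical (A : Set V) (m : ℕ) : Prop :=
  ∃ z ∈ chains k r A, z ∈ Finsupp.supported k k {l : List V | l.length = m} ∧
    boundary k z = 0 ∧
    (∀ x ∈ chains k r A, boundary k x = 0 →
      ∃ a : k, ∃ y ∈ chains k r A, x = a • z + boundary k y) ∧
    ∀ a : k, ∀ y ∈ chains k r A, a • z = boundary k y → a = 0

variable {k r}

theorem chains_mono {A B : Set V} (h : A ⊆ B) : chains k r A ≤ chains k r B :=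
  Finsupp.supported_mono fun _ hl => ⟨hl.1, fun x hx => h (hl.2 x hx)⟩

theorem boundary_mem_chains {A : Set V} {x : List V →₀ k} (hx : x ∈ chains k r A) :
    boundary k x ∈ chains k r A :=
  boundary_mem_supported k (S := chainLists r A) (S' := chainLists r A)
    (fun _ hl _ hs _ => ⟨hl.1.sublist hs, fun x hx => hl.2 x (hs.subset hx)⟩) hx

theorem lengthPart_mem_chains {A : Set V} {m : ℕ} {x : List V →₀ k}
    (hx : x ∈ chains k r A) : lengthPart k m x ∈ chains k r A :=
  Finsupp.supported_mono Set.inter_subset_left (lengthPart_mem k hx)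

theorem mem_chains_inter {A B : Set V} {x : List V →₀ k} (hA : x ∈ chains k r A)
    (hB : x ∈ chains k r B) : x ∈ chains k r (A ∩ B) := by
  rw [chains, Finsupp.mem_supported] at *
  intro l hl
  obtain ⟨h1, h2⟩ : l ∈ chainLists r A := hA hl
  obtain ⟨-, h3⟩ : l ∈ chainLists r B := hB hl
  exact ⟨h1, fun v hv => ⟨h2 v hv, h3 v hv⟩⟩

/-- A set of vertices is closed under passage to smaller vertices. -/
def DownClosed (r : V → V → Prop) (A : Set V) : Prop := ∀ x ∈ A, ∀ y, r x y → y ∈ A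

theorem exists_add_of_mem_union {A B : Set V} (hA : DownClosed r A) (hB : DownClosed r B)
    {x : List V →₀ k} (hx : x ∈ chains k r (A ∪ B)) :
    ∃ y ∈ chains k r A, ∃ z ∈ chains k r B, x = y + z := by
  have hsub : chainLists r (A ∪ B) ⊆ chainLists r A ∪ chainLists r B := by
    rintro l ⟨hl, hl'⟩
    cases l with
    | nil => exact Or.inl ⟨hl, by simp⟩
    | cons v l =>
      have hv : ∀ w ∈ l, r v w := fun w hw => List.rel_of_pairwise_cons hl hw
      rcases hl' v (by simp) with h | h
      · refine Or.inl ⟨hl, fun w hw => ?_⟩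
        rcases List.mem_cons.1 hw with rfl | hw
        · exact h
        · exact hA v h w (hv w hw)
      · refine Or.inr ⟨hl, fun w hw => ?_⟩
        rcases List.mem_cons.1 hw with rfl | hw
        · exact h
        · exact hB v h w (hv w hw)
  have h := Finsupp.supported_mono (M := k) (R := k) hsub hx
  rw [Finsupp.supported_union, Submodule.mem_sup] at h
  obtain ⟨y, hy, z, hz, h⟩ := h
  exact ⟨y, hy, z, hz, h.symm⟩

theorem IsAcyclic.union {A B : Set V} (hA : DownClosed r A) (hB : DownClosed r B)
    (hAa : IsAcyclic k r A) (hBa : IsAcyclic k r B) (hI : IsAcyclic k r (A ∩ B)) :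
    IsAcyclic k r (A ∪ B) := by
  intro x hx hx0
  obtain ⟨p, hp, q, hq, rfl⟩ := exists_add_of_mem_union hA hB hx
  have hpq : boundary k p = -boundary k q := by
    rw [map_add] at hx0; exact eq_neg_of_add_eq_zero_left hx0
  obtain ⟨w, hw, hwp⟩ := hI (boundary k p) (mem_chains_inter (boundary_mem_chains hp)
    (hpq ▸ neg_mem (boundary_mem_chains hq))) (boundary_boundary k p)
  obtain ⟨y, hy, hyp⟩ := hAa (p - w) (sub_mem hp (chains_mono Set.inter_subset_left hw))
    (by rw [map_sub, hwp, sub_self])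
  obtain ⟨z, hz, hzq⟩ := hBa (q + w) (add_mem hq (chains_mono Set.inter_subset_right hw))
    (by rw [map_add, hwp, hpq, add_neg_cancel])
  refine ⟨y + z, add_mem (chains_mono Set.subset_union_left hy)
    (chains_mono Set.subset_union_right hz), ?_⟩
  rw [map_add, hyp, hzq]; abel

theorem IsSpherical.union {A B : Set V} {m : ℕ} (hA : DownClosed r A) (hB : DownClosed r B)
    (hAa : IsAcyclic k r A) (hBa : IsAcyclic k r B) (hI : IsSpherical k r (A ∩ B) m) :
    IsSpherical k r (A ∪ B) (m + 1) := by
  obtain ⟨z, hz, hzm, hz0, hgen, hinj⟩ := hI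
  have lift : ∀ C : Set V, A ∩ B ⊆ C → IsAcyclic k r C → ∃ p ∈ chains k r C,
      p ∈ Finsupp.supported k k {l : List V | l.length = m + 1} ∧ boundary k p = z := by
    intro C hC hCa
    obtain ⟨p, hp, hpz⟩ := hCa z (chains_mono hC hz) hz0
    refine ⟨lengthPart k (m + 1) p, lengthPart_mem_chains hp,
      Finsupp.supported_mono Set.inter_subset_right (lengthPart_mem k hp), ?_⟩
    rw [← lengthPart_boundary, hpz, lengthPart_of_mem k hzm]
  obtain ⟨p, hp, hpm, hpz⟩ := lift A Set.inter_subset_left hAa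
  obtain ⟨q, hq, hqm, hqz⟩ := lift B Set.inter_subset_right hBa
  have hAU : chains k r A ≤ chains k r (A ∪ B) := chains_mono Set.subset_union_left
  have hBU : chains k r B ≤ chains k r (A ∪ B) := chains_mono Set.subset_union_right
  have hIA : chains k r (A ∩ B) ≤ chains k r A := chains_mono Set.inter_subset_left
  have hIB : chains k r (A ∩ B) ≤ chains k r B := chains_mono Set.inter_subset_right
  refine ⟨p - q, sub_mem (hAU hp) (hBU hq), sub_mem hpm hqm, by rw [map_sub, hpz, hqz, sub_self],
    ?_, ?_⟩
  · intro x hx hx0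
    obtain ⟨s, hs, t, ht, rfl⟩ := exists_add_of_mem_union hA hB hx
    have hst : boundary k s = -boundary k t := by
      rw [map_add] at hx0; exact eq_neg_of_add_eq_zero_left hx0
    obtain ⟨a, w, hw, hsw⟩ := hgen (boundary k s) (mem_chains_inter (boundary_mem_chains hs)
      (hst ▸ neg_mem (boundary_mem_chains ht))) (boundary_boundary k s)
    obtain ⟨y, hy, hys⟩ := hAa (s - a • p - w)
      (sub_mem (sub_mem hs (Submodule.smul_mem _ _ hp)) (hIA hw))
      (by rw [map_sub, map_sub, map_smul, hpz, hsw]; abel)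
    obtain ⟨y', hy', hyt⟩ := hBa (t + a • q + w)
      (add_mem (add_mem ht (Submodule.smul_mem _ _ hq)) (hIB hw))
      (by rw [map_add, map_add, map_smul, hqz, ← neg_eq_iff_eq_neg.2 hst, hsw]; abel)
    refine ⟨a, y + y', add_mem (hAU hy) (hBU hy'), ?_⟩
    rw [map_add, hys, hyt, smul_sub]; abel
  · intro a y hy hay
    obtain ⟨s, hs, t, ht, rfl⟩ := exists_add_of_mem_union hA hB hy
    have heq : a • p - boundary k s = a • q + boundary k t := by
      rw [map_add, smul_sub] at hay
      rw [sub_eq_iff_eq_add] at hay ⊢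
      rw [hay]; abel
    have hc := mem_chains_inter
      (sub_mem (Submodule.smul_mem _ a hp) (boundary_mem_chains hs))
      (heq ▸ add_mem (Submodule.smul_mem _ a hq) (boundary_mem_chains ht))
    refine hinj a _ hc ?_
    rw [map_sub, boundary_boundary, map_smul, hpz, sub_zero]

theorem isSpherical_empty : IsSpherical k r ∅ 0 := by
  refine ⟨Finsupp.single [] 1, Finsupp.single_mem_supported k _ ⟨List.Pairwise.nil, by simp⟩,
    Finsupp.single_mem_supported k _ (by simp), by simp [listBoundary], ?_, ?_⟩
  · intro x hx _
    refine ⟨x [], 0, zero_mem _, ?_⟩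
    ext l
    cases l with
    | nil => simp
    | cons v l =>
      simp only [map_zero, add_zero, Finsupp.smul_single, smul_eq_mul, mul_one, ne_eq,
        reduceCtorEq, not_false_eq_true, Finsupp.single_eq_of_ne]
      by_contra h
      exact (hx (Finsupp.mem_support_iff.2 h)).2 v (by simp)
  · intro a y hy hay
    have h1 : lengthPart k 0 (a • Finsupp.single ([] : List V) (1 : k)) = _ :=
      congrArg _ hay
    rw [lengthPart_boundary] at h1
    have h2 : lengthPart k 1 y = 0 := by
      rw [lengthPart, Finsupp.filter_eq_zero_iff]
      intro l hl
      by_contra h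
      cases l with
      | nil => simp at hl
      | cons v l => exact (hy (Finsupp.mem_support_iff.2 h)).2 v (by simp)
    rw [h2, map_zero, lengthPart_of_mem k
      (Submodule.smul_mem _ _ (Finsupp.single_mem_supported k _ (by simp)))] at h1
    simpa using h1

/-- A set with a greatest element has vanishing reduced homology. -/
theorem isAcyclic_of_greatest (hr : ∀ x y, r x y → ¬ r y x) {A : Set V} {v : V} (hv : v ∈ A)
    (hmax : ∀ x ∈ A, x ≠ v → r v x) : IsAcyclic k r A := by
  classical
  let f : List V → (List V →₀ k) := fun l =>
    if l.head? = some v then 0 else Finsupp.single (v :: l) 1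
  let h : (List V →₀ k) →ₗ[k] (List V →₀ k) := Finsupp.linearCombination k f
  have hcons : ∀ x : List V →₀ k, h (consMap k v x) = 0 := by
    intro x
    induction x using Finsupp.induction_linear with
    | zero => simp
    | add x y hx hy => simp only [map_add, hx, hy, add_zero]
    | single l a => simp [h, f]
  have hfree : ∀ x ∈ Finsupp.supported k k {l : List V | v ∉ l}, h x = consMap k v x := by
    intro x hx
    rw [Finsupp.supported_eq_span_single] at hx
    induction hx using Submodule.span_induction with
    | mem x hx =>
      obtain ⟨l, hl, rfl⟩ := hx
      have : l.head? ≠ some v := fun h' => hl (List.mem_of_mem_head? h')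
      simp [h, f, this]
    | zero => simp
    | add x y _ _ hx hy => simp only [map_add, hx, hy]
    | smul a x _ hx => simp only [map_smul, hx]
  have hnot : ∀ l ∈ chainLists r A, l.head? ≠ some v → v ∉ l := by
    rintro l ⟨hl, hl'⟩ hh hmem
    cases l with
    | nil => simp at hmem
    | cons w l =>
      have hwv : w ≠ v := by simpa using hh
      rcases List.mem_cons.1 hmem with h' | h'
      · exact hwv h'.symm
      · exact hr _ _ (hmax w (hl' w (by simp)) hwv) (List.rel_of_pairwise_cons hl h')
  have hhom : ∀ x ∈ chains k r A,
      boundary k (h x) + h (boundary k x) = x ∧ h x ∈ chains k r A := by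
    intro x hx
    rw [chains, Finsupp.supported_eq_span_single] at hx
    induction hx using Submodule.span_induction with
    | mem x hx =>
      obtain ⟨l, hl, rfl⟩ := hx
      by_cases hh : l.head? = some v
      · cases l with
        | nil => simp at hh
        | cons w l =>
          obtain rfl : w = v := by simpa using hh
          have hw : w ∉ l := fun h' => by
            have := List.rel_of_pairwise_cons hl.1 h'
            exact hr _ _ this this
          have h1 : h (Finsupp.single (w :: l) 1) = 0 := by simp [h, f]
          rw [h1]
          refine ⟨?_, zero_mem _⟩
          rw [map_zero, zero_add, boundary_single, one_smul, listBoundary, map_sub, hcons,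
            hfree _ (Finsupp.single_mem_supported k _ hw), consMap_single, sub_zero]
      · have hv' := hnot l hl hh
        rw [hfree _ (Finsupp.single_mem_supported k _ hv'), hfree _
          (boundary_mem_supported k (S := {l}) (by
            rintro _ rfl l' hs _ hmem; exact hv' (hs.subset hmem))
            (Finsupp.single_mem_supported k _ rfl)), boundary_consMap]
        refine ⟨by abel, ?_⟩
        rw [consMap_single]
        refine Finsupp.single_mem_supported k _ ⟨List.pairwise_cons.2 ⟨?_, hl.1⟩, ?_⟩
        · intro w hw
          exact hmax w (hl.2 w hw) (fun e => hv' (e ▸ hw))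
        · intro w hw
          rcases List.mem_cons.1 hw with rfl | hw
          · exact hv
          · exact hl.2 w hw
    | zero => simp
    | add x y _ _ hx hy =>
      refine ⟨?_, by rw [map_add]; exact add_mem hx.2 hy.2⟩
      simp only [map_add]
      nth_rewrite 3 [← hx.1]
      nth_rewrite 3 [← hy.1]
      abel
    | smul a x _ hx =>
      refine ⟨?_, by rw [map_smul]; exact Submodule.smul_mem _ _ hx.2⟩
      simp only [map_smul]
      rw [← smul_add, hx.1]
  intro x hx hx0
  refine ⟨h x, (hhom x hx).2, ?_⟩
  have := (hhom x hx).1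
  rwa [hx0, map_zero, add_zero] at this

end Homology

end OrderHomology

/-- A combinatorial model of the strata lying strictly between two cells of a configuration of
level-wise ordered vertices: every stratum `x : V` is described by level functions `W x` on the
set `N` of vertices. -/
structure TreeStrata (V N : Type*) where
  n : ℕ
  r : V → V → Prop
  lvl : N → ℕ
  par : N → N
  val : N → ℕ
  U : N → ℕ
  W : V → N → ℕ
  verts : Finset N
  mem_verts : ∀ a, a ∈ verts ↔ lvl a < n
  lvl_par : ∀ a, lvl (par a) = lvl a + 1
  eq_of_top : ∀ a b, lvl a = lvl b → n ≤ lvl a → a = b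
  eq_of_val : ∀ a b, lvl a = lvl b → val a = val b → a = b
  par_mono : ∀ a b, lvl a = lvl b → val a ≤ val b → val (par a) ≤ val (par b)
  exists_pred : ∀ b, val b ≠ 0 → ∃ c, lvl c = lvl b ∧ val c + 1 = val b
  U_par : ∀ a b, lvl a = lvl b → U a = U b → U (par a) = U (par b)
  U_mono : ∀ a b, par a = par b → val a ≤ val b → U a ≤ U b
  W_par : ∀ x a b, lvl a = lvl b → W x a ≤ W x b → W x (par a) ≤ W x (par b)
  U_le_of_W : ∀ x a b, lvl a = lvl b → W x a ≤ W x b → W x (par b) ≤ W x (par a) → U a ≤ U b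
  W_mono : ∀ x a b, par a = par b → val a ≤ val b → W x a ≤ W x b
  exists_tie : ∀ x, ∃ a b, lvl a = lvl b ∧ a ≠ b ∧ W x a = W x b
  exists_lt : ∀ x, ∃ a b, lvl a = lvl b ∧ U a = U b ∧ W x a < W x b
  r_asymm : ∀ x y, r x y → ¬ r y x
  W_of_r : ∀ x y, r x y → ∀ a b, lvl a = lvl b → W x a ≤ W x b →
    W x (par b) ≤ W x (par a) → W y a ≤ W y b
  r_of_W : ∀ x y, x ≠ y → (∀ a b, lvl a = lvl b → W x a ≤ W x b →
    W x (par b) ≤ W x (par a) → W y a ≤ W y b) → r x y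
  realize : ∀ R : N → N → Prop, (∀ a b, lvl a = lvl b → R a b ∨ R b a) →
    (∀ a b c, lvl a = lvl b → lvl b = lvl c → R a b → R b c → R a c) →
    (∀ a b, lvl a = lvl b → R a b → R (par a) (par b)) →
    (∀ a b, par a = par b → val a ≤ val b → R a b) →
    (∀ a b, lvl a = lvl b → R a b → R (par b) (par a) → U a ≤ U b) →
    (∃ a b, lvl a = lvl b ∧ a ≠ b ∧ R a b ∧ R b a) →
    (∃ a b, lvl a = lvl b ∧ U a = U b ∧ ¬ R b a) →
    ∃ x, ∀ a b, lvl a = lvl b → (W x a ≤ W x b ↔ R a b)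

namespace TreeStrata

open OrderHomology

variable {V N : Type*} (T : TreeStrata V N)

theorem lvl_eq_of_par {a b : N} (h : T.par a = T.par b) : T.lvl a = T.lvl b := by
  have := congrArg T.lvl h
  rw [T.lvl_par, T.lvl_par] at this
  omega

theorem lvl_par_eq {a b : N} (h : T.lvl a = T.lvl b) : T.lvl (T.par a) = T.lvl (T.par b) := by
  rw [T.lvl_par, T.lvl_par, h]

/-- Induction on vertices of equal level, starting from the top of the tree. -/
theorem top_induction {p : N → N → Prop} (h0 : ∀ a, p a a)
    (h : ∀ a b, T.lvl a = T.lvl b → p (T.par a) (T.par b) → p a b) (a b : N)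
    (hab : T.lvl a = T.lvl b) : p a b := by
  induction hk : T.n - T.lvl a generalizing a b with
  | zero => obtain rfl := T.eq_of_top a b hab (by omega); exact h0 a
  | succ k ih =>
    exact h a b hab (ih _ _ (T.lvl_par_eq hab) (by rw [T.lvl_par]; omega))

/-- A function which is compatible with the passage to parents and not injective on levels
identifies two siblings. -/
theorem exists_sibling_tie (f : N → ℕ)
    (hf : ∀ a b, T.lvl a = T.lvl b → f a = f b → f (T.par a) = f (T.par b))
    (h : ∃ a b, T.lvl a = T.lvl b ∧ a ≠ b ∧ f a = f b) :
    ∃ a b, T.par a = T.par b ∧ T.val a < T.val b ∧ f a = f b := by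
  by_contra hcon
  push Not at hcon
  obtain ⟨a, b, hab, hne, hfab⟩ := h
  refine hne (T.top_induction (p := fun a b => f a = f b → a = b) (fun _ _ => rfl) ?_ a b hab hfab)
  intro a b hab ih hfab
  have hp := ih (hf a b hab hfab)
  rcases lt_trichotomy (T.val a) (T.val b) with h | h | h
  · exact absurd hfab (hcon a b hp h)
  · exact T.eq_of_val a b hab h
  · exact absurd hfab.symm (hcon b a hp.symm h)

/-- The systems of weak inequalities between vertices which cut out convex unions of strata. -/
structure Valid (Q : N → N → Prop) : Prop where
  lvl : ∀ a b, Q a b → T.lvl a = T.lvl b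
  refl : ∀ a, Q a a
  trans : ∀ a b c, Q a b → Q b c → Q a c
  par : ∀ a b, Q a b → Q (T.par a) (T.par b) ∧ Q (T.par b) (T.par a)
  U : ∀ a b, Q a b → T.U a = T.U b
  sib : ∀ a b, T.par a = T.par b → T.val a ≤ T.val b → T.U a = T.U b → Q a b
  tie : ∃ a b, a ≠ b ∧ Q a b ∧ Q b a

/-- The set of strata satisfying a system of inequalities. -/
def region (Q : N → N → Prop) : Set V := {x | ∀ a b, Q a b → T.W x a ≤ T.W x b}

variable {T} {Q : N → N → Prop}

theorem Valid.downClosed (hQ : T.Valid Q) : DownClosed T.r (T.region Q) := fun x hx y hxy a b hab =>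
  T.W_of_r x y hxy a b (hQ.lvl a b hab) (hx a b hab) (hx _ _ (hQ.par a b hab).2)

/-- Two vertices are still to be compared by the system of inequalities. -/
def Free (T : TreeStrata V N) (Q : N → N → Prop) (a b : N) : Prop :=
  Q (T.par a) (T.par b) ∧ Q (T.par b) (T.par a) ∧ T.U a = T.U b ∧ ¬ Q a b ∧ ¬ Q b a

/-- Add the inequality `a ≤ b` to a system. -/
def addRel (Q : N → N → Prop) (a b x y : N) : Prop := Q x y ∨ (Q x a ∧ Q b y)

theorem Valid.addRel (hQ : T.Valid Q) {a b : N} (h1 : Q (T.par a) (T.par b))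
    (h2 : Q (T.par b) (T.par a)) (hU : T.U a = T.U b) : T.Valid (addRel Q a b) where
  lvl x y h := by
    rcases h with h | ⟨h, h'⟩
    · exact hQ.lvl _ _ h
    · have h3 := hQ.lvl _ _ h1
      rw [T.lvl_par, T.lvl_par] at h3
      have := hQ.lvl _ _ h
      have := hQ.lvl _ _ h'
      omega
  refl x := Or.inl (hQ.refl x)
  trans x y z hxy hyz := by
    rcases hxy with h | ⟨h, h'⟩ <;> rcases hyz with g | ⟨g, g'⟩
    · exact Or.inl (hQ.trans _ _ _ h g)
    · exact Or.inr ⟨hQ.trans _ _ _ h g, g'⟩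
    · exact Or.inr ⟨h, hQ.trans _ _ _ h' g⟩
    · exact Or.inr ⟨h, g'⟩
  par x y h := by
    rcases h with h | ⟨h, h'⟩
    · exact ⟨Or.inl (hQ.par _ _ h).1, Or.inl (hQ.par _ _ h).2⟩
    · exact ⟨Or.inl (hQ.trans _ _ _ (hQ.par _ _ h).1 (hQ.trans _ _ _ h1 (hQ.par _ _ h').1)),
        Or.inl (hQ.trans _ _ _ (hQ.par _ _ h').2 (hQ.trans _ _ _ h2 (hQ.par _ _ h).2))⟩
  U x y h := by
    rcases h with h | ⟨h, h'⟩
    · exact hQ.U _ _ h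
    · rw [hQ.U _ _ h, hU, hQ.U _ _ h']
  sib x y h h' h'' := Or.inl (hQ.sib x y h h' h'')
  tie := by
    obtain ⟨x, y, h, h', h''⟩ := hQ.tie
    exact ⟨x, y, h, Or.inl h', Or.inl h''⟩

theorem region_addRel (hQ : T.Valid Q) (a b : N) :
    T.region (addRel Q a b) = T.region Q ∩ {x | T.W x a ≤ T.W x b} := by
  ext x
  constructor
  · exact fun h => ⟨fun c d hcd => h c d (Or.inl hcd), h a b (Or.inr ⟨hQ.refl a, hQ.refl b⟩)⟩
  · rintro ⟨h, h'⟩ c d (hcd | ⟨hc, hd⟩)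
    · exact h c d hcd
    · exact (h c a hc).trans (le_trans h' (h b d hd))

theorem region_cut (hQ : T.Valid Q) (a b : N) :
    T.region Q = T.region (addRel Q a b) ∪ T.region (addRel Q b a) := by
  rw [region_addRel hQ, region_addRel hQ, ← Set.inter_union_distrib_left]
  refine (Set.inter_eq_left.2 fun x _ => ?_).symm
  exact le_total (T.W x a) (T.W x b)

/-- The number of inequalities missing from a system. -/
noncomputable def missing (T : TreeStrata V N) (Q : N → N → Prop) : ℕ :=
  ((T.verts ×ˢ T.verts).filter fun p => ¬ Q p.1 p.2).card

theorem missing_addRel_lt (hQ : T.Valid Q) {a b : N} (hab : T.lvl a = T.lvl b) (h : ¬ Q a b) :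
    T.missing (addRel Q a b) < T.missing Q := by
  have hlt : T.lvl a < T.n := by
    by_contra hn
    obtain rfl := T.eq_of_top a b hab (by omega)
    exact h (hQ.refl a)
  refine Finset.card_lt_card ⟨fun p hp => ?_, fun hsub => ?_⟩
  · simp only [Finset.mem_filter] at hp ⊢
    exact ⟨hp.1, fun h' => hp.2 (Or.inl h')⟩
  · have hmem : (a, b) ∈ (T.verts ×ˢ T.verts).filter fun p => ¬ Q p.1 p.2 := by
      simp [T.mem_verts, hlt, ← hab, h]
    have := hsub hmem
    simp only [Finset.mem_filter] at this
    exact this.2 (Or.inr ⟨hQ.refl a, hQ.refl b⟩)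

theorem missing_addRel_le (a b : N) : T.missing (addRel Q a b) ≤ T.missing Q := by
  refine Finset.card_le_card fun p hp => ?_
  simp only [Finset.mem_filter] at hp ⊢
  exact ⟨hp.1, fun h' => hp.2 (Or.inl h')⟩

theorem Free.lvl_eq (hQ : T.Valid Q) {a b : N} (h : T.Free Q a b) : T.lvl a = T.lvl b := by
  have := hQ.lvl _ _ h.1
  rw [T.lvl_par, T.lvl_par] at this
  omega

theorem Free.symm {a b : N} (h : T.Free Q a b) : T.Free Q b a :=
  ⟨h.2.1, h.1, h.2.2.1.symm, h.2.2.2.2, h.2.2.2.1⟩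

/-- Some inequality of the system is strict. -/
def Strict (Q : N → N → Prop) : Prop := ∃ c d, Q c d ∧ ¬ Q d c

theorem Strict.addRel (hQ : T.Valid Q) (h : Strict Q) {a b : N} (hba : ¬ Q b a) :
    Strict (addRel Q a b) := by
  obtain ⟨c, d, hcd, hdc⟩ := h
  refine ⟨c, d, Or.inl hcd, ?_⟩
  rintro (h | ⟨h, h'⟩)
  · exact hdc h
  · exact hba (hQ.trans _ _ _ h' (hQ.trans _ _ _ hcd h))

theorem Strict.addRel_addRel (hQ : T.Valid Q) (h : Strict Q) {a b : N} (hab : ¬ Q a b)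
    (hba : ¬ Q b a) : Strict (TreeStrata.addRel (TreeStrata.addRel Q a b) b a) := by
  obtain ⟨c, d, hcd, hdc⟩ := h
  refine ⟨c, d, Or.inl (Or.inl hcd), ?_⟩
  have tr := hQ.trans
  rintro ((h | ⟨h, h'⟩) | ⟨h | ⟨h, h'⟩, g | ⟨g, g'⟩⟩)
  · exact hdc h
  · exact hba (tr _ _ _ h' (tr _ _ _ hcd h))
  · exact hab (tr _ _ _ g (tr _ _ _ hcd h))
  · exact hdc (tr _ _ _ h g')
  · exact hdc (tr _ _ _ h g)
  · exact hba (tr _ _ _ g' (tr _ _ _ hcd h))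

/-- The lexicographic comparison of vertices attached to a system, computed in `k` steps. -/
def lexAux (T : TreeStrata V N) (Q : N → N → Prop) : ℕ → N → N → Prop
  | 0, _, _ => True
  | k + 1, a, b =>
    (Q (T.par a) (T.par b) ∧ Q (T.par b) (T.par a) ∧ (T.U a < T.U b ∨ Q a b)) ∨
    (¬ (Q (T.par a) (T.par b) ∧ Q (T.par b) (T.par a)) ∧ lexAux T Q k (T.par a) (T.par b))

/-- The lexicographic comparison of vertices attached to a system. -/
def lex (T : TreeStrata V N) (Q : N → N → Prop) (a b : N) : Prop :=
  T.lexAux Q (T.n - T.lvl a) a b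

theorem lex_iff (hQ : T.Valid Q) {a b : N} (hab : T.lvl a = T.lvl b) :
    T.lex Q a b ↔
      (Q (T.par a) (T.par b) ∧ Q (T.par b) (T.par a) ∧ (T.U a < T.U b ∨ Q a b)) ∨
      (¬ (Q (T.par a) (T.par b) ∧ Q (T.par b) (T.par a)) ∧ T.lex Q (T.par a) (T.par b)) := by
  by_cases h : T.lvl a < T.n
  · have : T.n - T.lvl a = (T.n - T.lvl (T.par a)) + 1 := by rw [T.lvl_par]; omega
    rw [lex, this, lexAux, lex]
  · obtain rfl := T.eq_of_top a b hab (by omega)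
    have : T.n - T.lvl a = 0 := by omega
    rw [lex, this, lexAux]
    simp [hQ.refl]

theorem lex_of_rel (hQ : T.Valid Q) {a b : N} (h : Q a b) : T.lex Q a b :=
  (lex_iff hQ (hQ.lvl a b h)).2 (Or.inl ⟨(hQ.par a b h).1, (hQ.par a b h).2, Or.inr h⟩)

theorem lex_tie (hQ : T.Valid Q) (a b : N) (hab : T.lvl a = T.lvl b) :
    T.lex Q a b → T.lex Q b a → Q a b ∧ Q b a := by
  refine T.top_induction (p := fun a b => T.lex Q a b → T.lex Q b a → Q a b ∧ Q b a)
    (fun a _ _ => ⟨hQ.refl a, hQ.refl a⟩) ?_ a b hab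
  intro a b hab ih h h'
  rw [lex_iff hQ hab] at h
  rw [lex_iff hQ hab.symm] at h'
  rcases h with ⟨h1, h2, h3⟩ | ⟨h1, h2⟩
  · rcases h' with ⟨-, -, h4⟩ | ⟨h4, -⟩
    · rcases h3 with h3 | h3
      · rcases h4 with h4 | h4
        · omega
        · have := hQ.U _ _ h4; omega
      · rcases h4 with h4 | h4
        · have := hQ.U _ _ h3; omega
        · exact ⟨h3, h4⟩
    · exact absurd ⟨h2, h1⟩ h4
  · rcases h' with ⟨h3, h4, -⟩ | ⟨-, h3⟩
    · exact absurd ⟨h4, h3⟩ h1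
    · exact absurd (ih h2 h3) h1

theorem lex_par (hQ : T.Valid Q) {a b : N} (hab : T.lvl a = T.lvl b) (h : T.lex Q a b) :
    T.lex Q (T.par a) (T.par b) := by
  rcases (lex_iff hQ hab).1 h with ⟨h1, -, -⟩ | ⟨-, h1⟩
  · exact lex_of_rel hQ h1
  · exact h1

theorem lex_total (hQ : T.Valid Q) (hfree : ∀ a b, ¬ T.Free Q a b) (a b : N)
    (hab : T.lvl a = T.lvl b) : T.lex Q a b ∨ T.lex Q b a := by
  refine T.top_induction (p := fun a b => T.lex Q a b ∨ T.lex Q b a)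
    (fun a => Or.inl (lex_of_rel hQ (hQ.refl a))) ?_ a b hab
  intro a b hab ih
  rw [lex_iff hQ hab, lex_iff hQ hab.symm]
  by_cases ht : Q (T.par a) (T.par b) ∧ Q (T.par b) (T.par a)
  · rcases lt_trichotomy (T.U a) (T.U b) with h | h | h
    · exact Or.inl (Or.inl ⟨ht.1, ht.2, Or.inl h⟩)
    · by_cases h1 : Q a b
      · exact Or.inl (Or.inl ⟨ht.1, ht.2, Or.inr h1⟩)
      · by_cases h2 : Q b a
        · exact Or.inr (Or.inl ⟨ht.2, ht.1, Or.inr h2⟩)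
        · exact absurd ⟨ht.1, ht.2, h, h1, h2⟩ (hfree a b)
    · exact Or.inr (Or.inl ⟨ht.2, ht.1, Or.inl h⟩)
  · rcases ih with h | h
    · exact Or.inl (Or.inr ⟨ht, h⟩)
    · exact Or.inr (Or.inr ⟨fun h' => ht h'.symm, h⟩)

theorem lex_trans (hQ : T.Valid Q) (a b c : N) (hab : T.lvl a = T.lvl b) (hbc : T.lvl b = T.lvl c)
    (h : T.lex Q a b) (h' : T.lex Q b c) : T.lex Q a c := by
  induction hk : T.n - T.lvl a generalizing a b c with
  | zero => obtain rfl := T.eq_of_top a b hab (by omega); exact h'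
  | succ k ih =>
    have hp : T.lex Q (T.par a) (T.par c) :=
      ih _ _ _ (T.lvl_par_eq hab) (T.lvl_par_eq hbc) (lex_par hQ hab h) (lex_par hQ hbc h')
        (by rw [T.lvl_par]; omega)
    rw [lex_iff hQ (hab.trans hbc)]
    by_cases ht : Q (T.par a) (T.par c) ∧ Q (T.par c) (T.par a)
    · refine Or.inl ⟨ht.1, ht.2, ?_⟩
      have hba : T.lex Q (T.par b) (T.par a) :=
        ih _ _ _ (T.lvl_par_eq hbc) (T.lvl_par_eq (hab.trans hbc)).symm (lex_par hQ hbc h')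
          (lex_of_rel hQ ht.2) (by rw [T.lvl_par]; omega)
      have t1 := lex_tie hQ _ _ (T.lvl_par_eq hab) (lex_par hQ hab h) hba
      have t2 : Q (T.par b) (T.par c) ∧ Q (T.par c) (T.par b) :=
        ⟨hQ.trans _ _ _ t1.2 ht.1, hQ.trans _ _ _ ht.2 t1.1⟩
      rcases (lex_iff hQ hab).1 h with ⟨-, -, h1⟩ | ⟨h1, -⟩
      · rcases (lex_iff hQ hbc).1 h' with ⟨-, -, h2⟩ | ⟨h2, -⟩
        · rcases h1 with h1 | h1
          · rcases h2 with h2 | h2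
            · exact Or.inl (h1.trans h2)
            · exact Or.inl (hQ.U _ _ h2 ▸ h1)
          · rcases h2 with h2 | h2
            · exact Or.inl (by rw [hQ.U _ _ h1]; exact h2)
            · exact Or.inr (hQ.trans _ _ _ h1 h2)
        · exact absurd t2 h2
      · exact absurd t1 h1
    · exact Or.inr ⟨ht, hp⟩

variable {k : Type*} [CommRing k]

/-- A complete system with a strict inequality defines a region with a greatest element. -/
theorem isAcyclic_of_complete (hQ : T.Valid Q) (hfree : ∀ a b, ¬ T.Free Q a b) (hs : Strict Q) :
    IsAcyclic k T.r (T.region Q) := by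
  obtain ⟨x, hx⟩ := T.realize (T.lex Q) (lex_total hQ hfree) (lex_trans hQ)
    (fun a b hab h => lex_par hQ hab h)
    (fun a b hp hv => (lex_iff hQ (T.lvl_eq_of_par hp)).2 (Or.inl
      ⟨hp ▸ hQ.refl _, hp ▸ hQ.refl _, (T.U_mono a b hp hv).lt_or_eq.imp_right
        (hQ.sib a b hp hv)⟩))
    (fun a b hab h h' => by
      have ht := lex_tie hQ _ _ (T.lvl_par_eq hab) (lex_par hQ hab h) h'
      rcases (lex_iff hQ hab).1 h with ⟨-, -, h1 | h1⟩ | ⟨h1, -⟩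
      · exact h1.le
      · exact (hQ.U _ _ h1).le
      · exact absurd ht h1)
    (by
      obtain ⟨a, b, hne, h, h'⟩ := hQ.tie
      exact ⟨a, b, hQ.lvl _ _ h, hne, lex_of_rel hQ h, lex_of_rel hQ h'⟩)
    (by
      obtain ⟨a, b, h, h'⟩ := hs
      exact ⟨a, b, hQ.lvl _ _ h, hQ.U _ _ h, fun hl =>
        h' (lex_tie hQ a b (hQ.lvl _ _ h) (lex_of_rel hQ h) hl).2⟩)
  refine isAcyclic_of_greatest (v := x) T.r_asymm
    (fun a b hab => (hx a b (hQ.lvl _ _ hab)).2 (lex_of_rel hQ hab)) fun y hy hyx => ?_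
  refine T.r_of_W x y hyx.symm fun a b hab h h' => ?_
  rw [hx a b hab] at h
  rw [hx _ _ (T.lvl_par_eq hab.symm)] at h'
  have ht := lex_tie hQ _ _ (T.lvl_par_eq hab) (lex_par hQ hab h) h'
  rcases (lex_iff hQ hab).1 h with ⟨-, -, h1 | h1⟩ | ⟨h1, -⟩
  · by_contra hlt
    have := T.U_le_of_W y b a hab.symm (le_of_not_ge hlt) (hy _ _ ht.1)
    omega
  · exact hy _ _ h1
  · exact absurd ht h1

theorem isAcyclic_region (hQ : T.Valid Q) (hs : Strict Q) : IsAcyclic k T.r (T.region Q) := by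
  induction hm : T.missing Q using Nat.strong_induction_on generalizing Q with
  | _ m ih =>
    subst hm
    by_cases hfree : ∃ a b, T.Free Q a b
    · obtain ⟨a, b, hab⟩ := hfree
      have hl := hab.lvl_eq hQ
      have h1 : T.Valid (addRel Q a b) := hQ.addRel hab.1 hab.2.1 hab.2.2.1
      have h2 : T.Valid (addRel Q b a) := hQ.addRel hab.2.1 hab.1 hab.2.2.1.symm
      have h3 : T.Valid (addRel (addRel Q a b) b a) :=
        h1.addRel (Or.inl hab.2.1) (Or.inl hab.1) hab.2.2.1.symm
      have l1 := missing_addRel_lt hQ hl hab.2.2.2.1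
      have l2 := missing_addRel_lt hQ hl.symm hab.2.2.2.2
      have l3 : T.missing (addRel (addRel Q a b) b a) < T.missing Q :=
        (missing_addRel_le b a).trans_lt l1
      have hI : T.region (addRel Q a b) ∩ T.region (addRel Q b a) =
          T.region (addRel (addRel Q a b) b a) := by
        rw [region_addRel h1, region_addRel hQ, region_addRel hQ]
        ext x; simp only [Set.mem_inter_iff]; tauto
      rw [region_cut hQ a b]
      refine IsAcyclic.union h1.downClosed h2.downClosed
        (ih _ l1 h1 (hs.addRel hQ hab.2.2.2.2) rfl)
        (ih _ l2 h2 (hs.addRel hQ hab.2.2.2.1) rfl) ?_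
      rw [hI]
      exact ih _ l3 h3 (hs.addRel_addRel hQ hab.2.2.2.1 hab.2.2.2.2) rfl
    · push Not at hfree
      exact isAcyclic_of_complete hQ hfree hs

end TreeStrata

namespace TreeStrata

open OrderHomology

variable {V N : Type*} {T : TreeStrata V N} {Q : N → N → Prop} {k : Type*} [CommRing k]

/-- The vertices below level `n` which are the first ones of their class. -/
noncomputable def reps (T : TreeStrata V N) (Q : N → N → Prop) : Finset N :=
  T.verts.filter fun b => ∀ a, T.lvl a = T.lvl b → T.val a < T.val b → ¬ Q a b

theorem mem_reps {b : N} : b ∈ T.reps Q ↔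
    T.lvl b < T.n ∧ ∀ a, T.lvl a = T.lvl b → T.val a < T.val b → ¬ Q a b := by
  rw [reps, Finset.mem_filter, T.mem_verts]

/-- The number of vertices of the target tree. -/
noncomputable def baseCard (T : TreeStrata V N) : ℕ := (T.reps fun a b => T.U a = T.U b).card

theorem baseCard_le (hQ : T.Valid Q) : T.baseCard ≤ (T.reps Q).card := by
  refine Finset.card_le_card fun b hb => ?_
  rw [mem_reps] at hb ⊢
  exact ⟨hb.1, fun a h h' h'' => hb.2 a h h' (hQ.U _ _ h'')⟩

theorem region_cut_inter (hQ : T.Valid Q) {a b : N} (h1 : T.Valid (addRel Q a b)) :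
    T.region (addRel Q a b) ∩ T.region (addRel Q b a) =
      T.region (addRel (addRel Q a b) b a) := by
  rw [region_addRel h1, region_addRel hQ, region_addRel hQ]
  ext x
  simp only [Set.mem_inter_iff]
  tauto

theorem exists_rep (hQ : T.Valid Q) (a : N) :
    ∃ c, Q c a ∧ ∀ d, Q d c → T.val c ≤ T.val d := by
  have h : ∃ v, ∃ c, Q c a ∧ T.val c = v := ⟨_, a, hQ.refl a, rfl⟩
  obtain ⟨c, hc, hv⟩ := Nat.find_spec h
  exact ⟨c, hc, fun d hd => hv ▸ Nat.find_min' h ⟨d, hQ.trans _ _ _ hd hc, rfl⟩⟩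

theorem exists_free_reps (hQ : T.Valid Q) (hsym : ∀ a b, Q a b → Q b a)
    (hfree : ∃ a b, T.Free Q a b) :
    ∃ a b, T.Free Q a b ∧ T.val a < T.val b ∧ (∀ d, Q d a → T.val a ≤ T.val d) ∧
      ∀ d, Q d b → T.val b ≤ T.val d := by
  obtain ⟨a, b, hab⟩ := hfree
  obtain ⟨c, hc, hc'⟩ := exists_rep hQ a
  obtain ⟨d, hd, hd'⟩ := exists_rep hQ b
  have tr := hQ.trans
  have hcd : T.Free Q c d :=
    ⟨tr _ _ _ (hQ.par _ _ hc).1 (tr _ _ _ hab.1 (hQ.par _ _ hd).2),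
      tr _ _ _ (hQ.par _ _ hd).1 (tr _ _ _ hab.2.1 (hQ.par _ _ hc).2),
      by rw [hQ.U _ _ hc, hab.2.2.1, hQ.U _ _ hd],
      fun h => hab.2.2.2.1 (tr _ _ _ (hsym _ _ hc) (tr _ _ _ h hd)),
      fun h => hab.2.2.2.2 (tr _ _ _ (hsym _ _ hd) (tr _ _ _ h hc))⟩
  rcases lt_trichotomy (T.val c) (T.val d) with h | h | h
  · exact ⟨c, d, hcd, h, hc', hd'⟩
  · obtain rfl := T.eq_of_val c d (hcd.lvl_eq hQ) h
    exact absurd (hQ.refl c) hcd.2.2.2.1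
  · exact ⟨d, c, hcd.symm, h, hd', hc'⟩

theorem reps_addRel_addRel (hQ : T.Valid Q) (hsym : ∀ a b, Q a b → Q b a) {a b : N}
    (hab : T.Free Q a b) (hlt : T.val a < T.val b) (ha : ∀ d, Q d a → T.val a ≤ T.val d)
    (hb : ∀ d, Q d b → T.val b ≤ T.val d) :
    T.reps (addRel (addRel Q a b) b a) = (T.reps Q).erase b := by
  ext x
  rw [Finset.mem_erase, mem_reps, mem_reps]
  constructor
  · rintro ⟨h1, h2⟩
    refine ⟨?_, h1, fun c h h' h'' => h2 c h h' (Or.inl (Or.inl h''))⟩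
    rintro rfl
    exact h2 a (hab.lvl_eq hQ) hlt (Or.inl (Or.inr ⟨hQ.refl _, hQ.refl _⟩))
  · rintro ⟨h0, h1, h2⟩
    refine ⟨h1, fun c h h' h'' => ?_⟩
    have eq_of : ∀ e, (∀ d, Q d e → T.val e ≤ T.val d) → Q e x → e = x := fun e he hex => by
      have hl := hQ.lvl _ _ hex
      refine T.eq_of_val _ _ hl (le_antisymm (he x (hsym _ _ hex)) ?_)
      by_contra hcon
      exact h2 e hl (by omega) hex
    rcases h'' with (g | ⟨g, g'⟩) | ⟨hcb, g | ⟨g, g'⟩⟩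
    · exact h2 c h h' g
    · exact h0 (eq_of b hb g').symm
    · have hax := congrArg T.val (eq_of a ha g)
      rcases hcb with g | ⟨g, -⟩
      · have := hb c g
        omega
      · have := ha c g
        omega
    · exact h0 (eq_of b hb g').symm

/-- The region cut out by a system of equalities is a sphere. -/
theorem isSpherical_region (hQ : T.Valid Q) (hsym : ∀ a b, Q a b → Q b a) (m : ℕ)
    (hm : (T.reps Q).card = T.baseCard + m) : IsSpherical k T.r (T.region Q) m := by
  induction hμ : T.missing Q using Nat.strong_induction_on generalizing Q m with
  | _ μ ih =>
    subst hμ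
    by_cases hfree : ∃ a b, T.Free Q a b
    · obtain ⟨a, b, hab, hlt, ha, hb⟩ := exists_free_reps hQ hsym hfree
      have hl := hab.lvl_eq hQ
      have h1 : T.Valid (addRel Q a b) := hQ.addRel hab.1 hab.2.1 hab.2.2.1
      have h2 : T.Valid (addRel Q b a) := hQ.addRel hab.2.1 hab.1 hab.2.2.1.symm
      have h3 : T.Valid (addRel (addRel Q a b) b a) :=
        h1.addRel (Or.inl hab.2.1) (Or.inl hab.1) hab.2.2.1.symm
      have l3 : T.missing (addRel (addRel Q a b) b a) < T.missing Q :=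
        (missing_addRel_le b a).trans_lt (missing_addRel_lt hQ hl hab.2.2.2.1)
      have hs : ∀ c d, T.Free Q c d → Strict (addRel Q c d) := fun c d hcd =>
        ⟨c, d, Or.inr ⟨hQ.refl c, hQ.refl d⟩, fun h =>
          h.elim hcd.2.2.2.2 fun h => hcd.2.2.2.2 h.1⟩
      have hcard := Finset.card_erase_add_one (mem_reps.2 ⟨?_, fun c _ h h' => ?_⟩ : b ∈ T.reps Q)
      · rw [← reps_addRel_addRel hQ hsym hab hlt ha hb] at hcard
        have hle := baseCard_le h3
        obtain ⟨m, rfl⟩ : ∃ m', m = m' + 1 := ⟨m - 1, by omega⟩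
        rw [region_cut hQ a b]
        refine IsSpherical.union h1.downClosed h2.downClosed
          (isAcyclic_region h1 (hs a b hab)) (isAcyclic_region h2 (hs b a hab.symm)) ?_
        rw [region_cut_inter hQ h1]
        refine ih _ l3 h3 ?_ m (by omega) rfl
        rintro x y ((h | ⟨h, h'⟩) | ⟨h | ⟨h, h'⟩, g | ⟨g, g'⟩⟩)
        · exact Or.inl (Or.inl (hsym _ _ h))
        · exact Or.inr ⟨Or.inl (hsym _ _ h'), Or.inl (hsym _ _ h)⟩
        · exact Or.inl (Or.inr ⟨hsym _ _ g, hsym _ _ h⟩)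
        · exact Or.inl (Or.inl (hQ.trans _ _ _ (hsym _ _ g') (hsym _ _ h)))
        · exact Or.inl (Or.inl (hQ.trans _ _ _ (hsym _ _ g) (hsym _ _ h)))
        · exact Or.inr ⟨Or.inl (hsym _ _ g'), Or.inl (hsym _ _ h)⟩
      · by_contra hn
        obtain rfl := T.eq_of_top a b hl (by omega)
        exact hab.2.2.2.1 (hQ.refl a)
      · have := hb c h'
        omega
    · have hall : ∀ a b, T.lvl a = T.lvl b → T.U a = T.U b → Q a b := by
        refine T.top_induction (p := fun a b => T.U a = T.U b → Q a b) (fun a _ => hQ.refl a) ?_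
        intro a b hab ih hU
        have hp := ih (T.U_par a b hab hU)
        by_contra hQab
        exact hfree ⟨a, b, hp, hsym _ _ hp, hU, hQab, fun h => hQab (hsym _ _ h)⟩
      have hreps : T.reps Q = T.reps fun a b => T.U a = T.U b := by
        ext b
        rw [mem_reps, mem_reps]
        refine and_congr_right fun _ => forall_congr' fun a => forall_congr' fun h =>
          forall_congr' fun _ => not_congr ⟨hQ.U a b, hall a b h⟩
      rw [hreps, ← baseCard] at hm
      obtain rfl : m = 0 := by omega
      have hempty : T.region Q = ∅ := by
        refine Set.eq_empty_of_forall_notMem fun x hx => ?_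
        obtain ⟨a, b, hab, hU, hlt⟩ := T.exists_lt x
        have := hx b a (hall b a hab.symm hU.symm)
        omega
      rw [hempty]
      exact isSpherical_empty

/-- The vertices which can be merged with their left neighbour. -/
noncomputable def walls (T : TreeStrata V N) : Finset N :=
  T.verts.filter fun c => ∃ a, T.par a = T.par c ∧ T.val a < T.val c ∧ T.U a = T.U c

theorem mem_walls {c : N} : c ∈ T.walls ↔
    T.lvl c < T.n ∧ ∃ a, T.par a = T.par c ∧ T.val a < T.val c ∧ T.U a = T.U c := by
  rw [walls, Finset.mem_filter, T.mem_verts]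

/-- The system of inequalities of the face on which the vertices of `F` are merged with their
left neighbours. -/
def faceRel (T : TreeStrata V N) (F : Finset N) (a b : N) : Prop :=
  T.par a = T.par b ∧ T.U a = T.U b ∧
    ∀ c, T.lvl c = T.lvl a → T.val b < T.val c → T.val c ≤ T.val a → c ∈ F

theorem par_eq_of_between {a b c : N} (hp : T.par a = T.par b) (hc : T.lvl c = T.lvl a)
    (h1 : T.val b ≤ T.val c) (h2 : T.val c ≤ T.val a) : T.par c = T.par b := by
  have hab := T.lvl_eq_of_par hp
  refine T.eq_of_val _ _ (T.lvl_par_eq (hc.trans hab)) (le_antisymm ?_ ?_)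
  · rw [← hp]; exact T.par_mono _ _ hc h2
  · exact T.par_mono _ _ (hc.trans hab).symm h1

theorem U_eq_of_between {a b c : N} (hp : T.par a = T.par b) (hU : T.U a = T.U b)
    (hc : T.lvl c = T.lvl a) (h1 : T.val b ≤ T.val c) (h2 : T.val c ≤ T.val a) :
    T.U c = T.U b := by
  have hcp := par_eq_of_between hp hc h1 h2
  refine le_antisymm ?_ (T.U_mono _ _ hcp.symm h1)
  rw [← hU]
  exact T.U_mono _ _ (hcp.trans hp.symm) h2

theorem exists_faceRel_of_mem {F : Finset N} {c : N} (hc : c ∈ T.walls) :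
    ∃ a, T.faceRel F a c ∧ a ≠ c ∧ T.val a < T.val c ∧ ∀ d, T.lvl d = T.lvl c →
      T.val a < T.val d → T.val d ≤ T.val c → d = c := by
  obtain ⟨-, b, hp, hlt, hU⟩ := mem_walls.1 hc
  obtain ⟨a, hal, hav⟩ := T.exists_pred c (by omega)
  have ha := par_eq_of_between hp.symm hal (by omega) (by omega)
  have haU := U_eq_of_between hp.symm hU.symm hal (by omega) (by omega)
  refine ⟨a, ⟨ha.trans hp, haU.trans hU, fun d _ h h' => by omega⟩, ?_, by omega, ?_⟩
  · rintro rfl; omega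
  · exact fun d hd h h' => T.eq_of_val _ _ hd (by omega)

theorem faceRel_swap_iff {F : Finset N} {a c : N} (h : T.faceRel F a c) (hlt : T.val a < T.val c)
    (hd : ∀ d, T.lvl d = T.lvl c → T.val a < T.val d → T.val d ≤ T.val c → d = c) :
    T.faceRel F c a ↔ c ∈ F :=
  ⟨fun h' => h'.2.2 c rfl hlt le_rfl,
    fun h' => ⟨h.1.symm, h.2.1.symm, fun d h1 h2 h3 => hd d h1 h2 h3 ▸ h'⟩⟩

theorem valid_faceRel {F : Finset N} (hF : F ⊆ T.walls) (hne : F.Nonempty) :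
    T.Valid (T.faceRel F) where
  lvl a b h := T.lvl_eq_of_par h.1
  refl a := ⟨rfl, rfl, fun c _ h h' => by omega⟩
  trans a b c h h' := by
    refine ⟨h.1.trans h'.1, h.2.1.trans h'.2.1, fun d hd h1 h2 => ?_⟩
    by_cases hdb : T.val b < T.val d
    · exact h.2.2 d hd hdb h2
    · exact h'.2.2 d (hd.trans (T.lvl_eq_of_par h.1)) h1 (by omega)
  par a b h := by
    rw [h.1]
    exact ⟨⟨rfl, rfl, fun c _ h h' => by omega⟩, ⟨rfl, rfl, fun c _ h h' => by omega⟩⟩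
  U a b h := h.2.1
  sib a b h h' h'' := ⟨h, h'', fun c _ h1 h2 => by omega⟩
  tie := by
    obtain ⟨c, hc⟩ := hne
    obtain ⟨a, ha, hne, hlt, hd⟩ := exists_faceRel_of_mem (F := F) (hF hc)
    exact ⟨a, c, hne, ha, (faceRel_swap_iff ha hlt hd).2 hc⟩

theorem strict_faceRel {F : Finset N} (hF : ∃ c ∈ T.walls, c ∉ F) : Strict (T.faceRel F) := by
  obtain ⟨c, hc, hcF⟩ := hF
  obtain ⟨a, ha, hne, hlt, hd⟩ := exists_faceRel_of_mem (F := F) hc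
  exact ⟨a, c, ha, fun h => hcF ((faceRel_swap_iff ha hlt hd).1 h)⟩

theorem faceRel_walls {a b : N} (hp : T.par a = T.par b) (hU : T.U a = T.U b)
    (hlt : T.lvl a < T.n) : T.faceRel T.walls a b := by
  refine ⟨hp, hU, fun c hc h h' => mem_walls.2 ⟨hc ▸ hlt, b, ?_, h, ?_⟩⟩
  · exact (par_eq_of_between hp hc h.le h').symm
  · exact (U_eq_of_between hp hU hc h.le h').symm

theorem faceRel_walls_symm (a b : N) (h : T.faceRel T.walls a b) : T.faceRel T.walls b a := by
  have hab := T.lvl_eq_of_par h.1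
  by_cases hlt : T.lvl b < T.n
  · exact faceRel_walls h.1.symm h.2.1.symm hlt
  · obtain rfl := T.eq_of_top a b hab (by omega)
    exact h

theorem reps_faceRel_walls : T.reps (T.faceRel T.walls) = T.verts \ T.walls := by
  ext b
  rw [Finset.mem_sdiff, mem_reps, mem_walls, T.mem_verts]
  refine and_congr_right fun hb => ?_
  rw [not_and, forall_prop_of_true hb, not_exists]
  refine forall_congr' fun a => ⟨fun h h' => ?_, fun h h1 h2 h3 => h ⟨h3.1, h2, h3.2.1⟩⟩
  have hl := T.lvl_eq_of_par h'.1
  exact h hl h'.2.1 (faceRel_walls h'.1 h'.2.2 (hl ▸ hb))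

theorem mem_region_faceRel_union {F G : Finset N} {x : V} (hF : x ∈ T.region (T.faceRel F))
    (hG : x ∈ T.region (T.faceRel G)) : x ∈ T.region (T.faceRel (F ∪ G)) := by
  intro a b h
  induction hd : T.val a - T.val b generalizing a with
  | zero => exact T.W_mono x a b h.1 (by omega)
  | succ d ih =>
    obtain ⟨c, hcl, hcv⟩ := T.exists_pred a (by omega)
    have hcp := par_eq_of_between h.1 hcl (by omega) (by omega)
    have hcU := U_eq_of_between h.1 h.2.1 hcl (by omega) (by omega)
    have hcb : T.W x c ≤ T.W x b := ih c ⟨hcp, hcU, fun e h1 h2 h3 =>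
      h.2.2 e (h1.trans hcl) h2 (by omega)⟩ (by omega)
    refine le_trans ?_ hcb
    have huniq : ∀ e, T.lvl e = T.lvl a → T.val c < T.val e → T.val e ≤ T.val a → e = a :=
      fun e h1 h2 h3 => T.eq_of_val _ _ h1 (by omega)
    rcases Finset.mem_union.1 (h.2.2 a rfl (by omega) le_rfl) with ha | ha
    · exact hF a c ⟨h.1.trans hcp.symm, h.2.1.trans hcU.symm, fun e h1 h2 h3 =>
        huniq e h1 h2 h3 ▸ ha⟩
    · exact hG a c ⟨h.1.trans hcp.symm, h.2.1.trans hcU.symm, fun e h1 h2 h3 =>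
        huniq e h1 h2 h3 ▸ ha⟩

theorem region_faceRel_anti {F G : Finset N} (h : F ⊆ G) :
    T.region (T.faceRel G) ⊆ T.region (T.faceRel F) :=
  fun _ hx a b hab => hx a b ⟨hab.1, hab.2.1, fun c h1 h2 h3 => h (hab.2.2 c h1 h2 h3)⟩

/-- The strata of the face `F` which lie on one of the walls in `S`. -/
def wallUnion (T : TreeStrata V N) (F S : Finset N) : Set V :=
  ⋃ s ∈ S, T.region (T.faceRel (insert s F))

theorem downClosed_wallUnion {F S : Finset N} (hF : F ⊆ T.walls) (hS : S ⊆ T.walls) :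
    DownClosed T.r (T.wallUnion F S) := by
  intro x hx y hxy
  simp only [wallUnion, Set.mem_iUnion] at hx ⊢
  obtain ⟨s, hs, hx⟩ := hx
  exact ⟨s, hs, (valid_faceRel (Finset.insert_subset (hS hs) hF)
    (Finset.insert_nonempty _ _)).downClosed x hx y hxy⟩

theorem wallUnion_insert (F S : Finset N) (s : N) :
    T.wallUnion F (insert s S) = T.region (T.faceRel (insert s F)) ∪ T.wallUnion F S := by
  rw [wallUnion, Finset.set_biUnion_insert, ← wallUnion]

theorem region_inter_wallUnion (F S : Finset N) (s : N) :
    T.region (T.faceRel (insert s F)) ∩ T.wallUnion F S = T.wallUnion (insert s F) S := by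
  ext x
  simp only [wallUnion, Set.mem_inter_iff, Set.mem_iUnion]
  constructor
  · rintro ⟨h, s', hs', h'⟩
    refine ⟨s', hs', region_faceRel_anti ?_ (mem_region_faceRel_union h h')⟩
    intro c; simp only [Finset.mem_insert, Finset.mem_union]; tauto
  · rintro ⟨s', hs', h⟩
    refine ⟨region_faceRel_anti (Finset.subset_insert _ _) h, s', hs', region_faceRel_anti ?_ h⟩
    intro c; simp only [Finset.mem_insert]; tauto

theorem wallUnion_homology {m : ℕ} (hm : (T.reps (T.faceRel T.walls)).card = T.baseCard + m)
    {S : Finset N} (hne : S.Nonempty) (F : Finset N) (hF : F ⊆ T.walls) (hS : S ⊆ T.walls)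
    (hFS : Disjoint S F) :
    ((∃ c ∈ T.walls, c ∉ F ∧ c ∉ S) → IsAcyclic k T.r (T.wallUnion F S)) ∧
    (T.walls = F ∪ S → ∀ e, m + S.card = e + 1 → IsSpherical k T.r (T.wallUnion F S) e) := by
  induction hne using Finset.Nonempty.cons_induction generalizing F with
  | singleton s =>
    have hval := valid_faceRel (T := T) (F := insert s F)
      (Finset.insert_subset (hS (by simp)) hF) (Finset.insert_nonempty _ _)
    have hU : T.wallUnion F {s} = T.region (T.faceRel (insert s F)) := by simp [wallUnion]
    rw [hU]
    constructor
    · rintro ⟨c, hc, hcF, hcs⟩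
      refine isAcyclic_region hval (strict_faceRel ⟨c, hc, ?_⟩)
      simp only [Finset.mem_insert, Finset.mem_singleton] at hcs ⊢
      tauto
    · intro h e he
      have hw : insert s F = T.walls := by rw [h, Finset.union_comm]; rfl
      rw [hw] at hval ⊢
      rw [Finset.card_singleton] at he
      exact isSpherical_region hval faceRel_walls_symm e (by omega)
  | cons s S hsS hne ih =>
    have hsw : s ∈ T.walls := hS (by simp)
    have hSw : S ⊆ T.walls := fun c hc => hS (by simp [hc])
    have hsF : s ∉ F := Finset.disjoint_left.1 hFS (by simp)
    have hdisj : Disjoint S F := Finset.disjoint_of_subset_left (by simp) hFS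
    have hdisj' : Disjoint S (insert s F) := by
      rw [Finset.disjoint_insert_right]; exact ⟨hsS, hdisj⟩
    have hFw : insert s F ⊆ T.walls := Finset.insert_subset hsw hF
    have hval := valid_faceRel hFw (Finset.insert_nonempty _ _)
    have hA : IsAcyclic k T.r (T.region (T.faceRel (insert s F))) := by
      obtain ⟨c, hc⟩ := hne
      exact isAcyclic_region hval
        (strict_faceRel ⟨c, hSw hc, Finset.disjoint_left.1 hdisj' hc⟩)
    have hB : IsAcyclic k T.r (T.wallUnion F S) := (ih F hF hSw hdisj).1 ⟨s, hsw, hsF, hsS⟩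
    have hI := ih (insert s F) hFw hSw hdisj'
    rw [Finset.cons_eq_insert, wallUnion_insert]
    constructor
    · rintro ⟨c, hc, hcF, hcS⟩
      refine IsAcyclic.union hval.downClosed (downClosed_wallUnion hF hSw) hA hB ?_
      rw [region_inter_wallUnion]
      refine hI.1 ⟨c, hc, ?_, fun h => hcS (by simp [h])⟩
      simp only [Finset.mem_insert] at hcS ⊢
      tauto
    · intro h e he
      rw [Finset.card_insert_of_notMem hsS] at he
      have := Finset.card_pos.2 hne
      obtain ⟨e, rfl⟩ : ∃ e', e = e' + 1 := ⟨e - 1, by omega⟩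
      refine IsSpherical.union hval.downClosed (downClosed_wallUnion hF hSw) hA hB ?_
      rw [region_inter_wallUnion]
      refine hI.2 ?_ e (by omega)
      rw [h, Finset.insert_union, Finset.union_insert]

theorem wallUnion_eq_univ : T.wallUnion ∅ T.walls = Set.univ := by
  refine Set.eq_univ_of_forall fun x => ?_
  obtain ⟨a, b, hp, hlt, hW⟩ := T.exists_sibling_tie (T.W x)
    (fun a b hab h => le_antisymm (T.W_par x a b hab h.le) (T.W_par x b a hab.symm h.ge))
    (T.exists_tie x)
  have hl := T.lvl_eq_of_par hp
  have hpW : T.W x (T.par a) = T.W x (T.par b) := by rw [hp]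
  have hU : T.U a = T.U b := le_antisymm (T.U_le_of_W x a b hl hW.le hpW.ge)
    (T.U_le_of_W x b a hl.symm hW.ge hpW.le)
  have hbn : T.lvl b < T.n := by
    by_contra hn
    obtain rfl := T.eq_of_top a b hl (by omega)
    omega
  simp only [wallUnion, Set.mem_iUnion]
  refine ⟨b, mem_walls.2 ⟨hbn, a, hp, hlt, hU⟩, fun p q hpq => ?_⟩
  by_cases hv : T.val p ≤ T.val q
  · exact T.W_mono x p q hpq.1 hv
  · obtain rfl : p = b := by simpa using hpq.2.2 p rfl (by omega) le_rfl
    rw [← hW]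
    refine T.W_mono x a q (hp.trans hpq.1) ?_
    by_contra hcon
    have : a = p := by simpa using hpq.2.2 a hl (by omega) hlt.le
    subst this
    omega

theorem isSpherical_univ {e : ℕ} (he : T.verts.card = T.baseCard + (e + 1)) :
    IsSpherical k T.r Set.univ e := by
  have hne : T.walls.Nonempty := by
    by_contra hempty
    rw [Finset.not_nonempty_iff_eq_empty] at hempty
    have : T.reps (fun a b => T.U a = T.U b) = T.verts := by
      refine Finset.filter_true_of_mem fun b hb a hab hlt hU => ?_
      obtain ⟨a', b', hp, hlt', hU'⟩ := T.exists_sibling_tie T.U (T.U_par)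
        ⟨a, b, hab, by rintro rfl; omega, hU⟩
      have hbn : T.lvl b' < T.n := by
        by_contra hn
        obtain rfl := T.eq_of_top a' b' (T.lvl_eq_of_par hp)
          (by rw [T.lvl_eq_of_par hp]; omega)
        omega
      have : b' ∈ T.walls := mem_walls.2 ⟨hbn, a', hp, hlt', hU'⟩
      simp [hempty] at this
    rw [baseCard, this] at he
    omega
  have hsub : T.walls ⊆ T.verts := Finset.filter_subset _ _
  have hcard := Finset.card_sdiff_add_card_eq_card hsub
  have hle := baseCard_le (valid_faceRel (T := T) subset_rfl hne)
  rw [← reps_faceRel_walls] at hcard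
  have h := (wallUnion_homology (T := T) (k := k)
    (m := (T.reps (T.faceRel T.walls)).card - T.baseCard) (by omega) hne ∅
    (Finset.empty_subset _) subset_rfl (Finset.disjoint_empty_right _)).2
    (Finset.empty_union _).symm e (by omega)
  rwa [wallUnion_eq_univ] at h

end TreeStrata

namespace PTree

variable {n : ℕ} {τ σ θ ρ : PTree n}

theorem comp_app (f : τ ⟶ θ) (g : θ ⟶ σ) (i : ℕ) (x : Fin (τ.t i)) :
    PTreeHom.app (f ≫ g) i x = PTreeHom.app g i (PTreeHom.app f i x) := rfl

theorem subsingleton_of_le (τ : PTree n) {i : ℕ} (hi : n ≤ i) : Subsingleton (Fin (τ.t i)) := by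
  rw [τ.top i hi]
  infer_instance

theorem injective_of_isIdentityHom {f : τ ⟶ σ} (hf : IsIdentityHom f) (i : ℕ) :
    Function.Injective (PTreeHom.app f i) := by
  obtain ⟨rfl, rfl⟩ := hf
  exact Function.injective_id

theorem strictMono_of_injective {f : τ ⟶ σ} (hf : ∀ i, Function.Injective (PTreeHom.app f i))
    (i : ℕ) : StrictMono (PTreeHom.app f i) := by
  induction hk : n - i generalizing i with
  | zero =>
    have := τ.subsingleton_of_le (i := i) (by omega)
    exact Subsingleton.strictMono _
  | succ k ih =>
    refine Monotone.strictMono_of_injective (fun x y hxy => ?_) (hf i)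
    rcases (τ.mono i hxy).eq_or_lt with h | h
    · exact PTreeHom.fiberMono f i x y h hxy
    · have h' := ih (i + 1) (by omega) h
      rw [PTreeHom.comm f, PTreeHom.comm f] at h'
      exact ((σ.mono i).reflect_lt h').le

theorem isIdentityHom_of_injective {f : τ ⟶ σ}
    (hf : ∀ i, Function.Injective (PTreeHom.app f i)) : IsIdentityHom f := by
  have hmono := strictMono_of_injective hf
  have ht : τ.t = σ.t := by
    funext i
    have := Fintype.card_of_bijective ⟨hf i, PTreeHom.surj f i⟩
    simpa using this
  obtain ⟨t, map, _, _, _⟩ := τ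
  obtain ⟨t', map', _, _, _⟩ := σ
  obtain rfl : t = t' := ht
  obtain ⟨app, surj, comm, _⟩ := f
  obtain rfl : app = fun _ => _root_.id := by
    funext i
    have := Subsingleton.elim
      (StrictMono.orderIsoOfSurjective _ (hmono i) (surj i)) (OrderIso.refl _)
    exact congrArg (fun g : Fin (t i) ≃o Fin (t i) => (g : Fin (t i) → Fin (t i))) this
  obtain rfl : map = map' := by
    funext i x
    exact comm i x
  exact ⟨rfl, rfl⟩

/-- A morphism factors through another one as soon as it respects the comparisons between
vertices with comparable images. -/
theorem exists_comp_eq (f : τ ⟶ θ) (g : τ ⟶ ρ)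
    (h : ∀ i a b, PTreeHom.app f i a ≤ PTreeHom.app f i b →
      PTreeHom.app f (i + 1) (τ.map i b) ≤ PTreeHom.app f (i + 1) (τ.map i a) →
      PTreeHom.app g i a ≤ PTreeHom.app g i b) : ∃ z : θ ⟶ ρ, f ≫ z = g := by
  have hpar : ∀ i a b, PTreeHom.app f i a = PTreeHom.app f i b →
      PTreeHom.app f (i + 1) (τ.map i a) = PTreeHom.app f (i + 1) (τ.map i b) := by
    intro i a b hab
    rw [PTreeHom.comm f, PTreeHom.comm f, hab]
  have hfac : ∀ i a, PTreeHom.app g i (Function.surjInv (PTreeHom.surj f i)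
      (PTreeHom.app f i a)) = PTreeHom.app g i a := by
    intro i a
    have e := Function.surjInv_eq (PTreeHom.surj f i) (PTreeHom.app f i a)
    exact le_antisymm (h i _ _ e.le (hpar i _ _ e).ge) (h i _ _ e.ge (hpar i _ _ e).le)
  refine ⟨⟨fun i y => PTreeHom.app g i (Function.surjInv (PTreeHom.surj f i) y), ?_, ?_, ?_⟩,
    PTreeHom.ext' (funext fun i => funext fun a => hfac i a)⟩
  · intro i y
    obtain ⟨a, rfl⟩ := PTreeHom.surj g i y
    exact ⟨_, hfac i a⟩
  · intro i y
    obtain ⟨a, rfl⟩ := PTreeHom.surj f i y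
    rw [hfac, ← PTreeHom.comm f, hfac, PTreeHom.comm g]
  · intro i y y' hyy hle
    obtain ⟨a, rfl⟩ := PTreeHom.surj f i y
    obtain ⟨b, rfl⟩ := PTreeHom.surj f i y'
    rw [hfac, hfac]
    exact h i a b hle (by rw [PTreeHom.comm f, PTreeHom.comm f, hyy])

theorem hom_ext_of_comp {f : τ ⟶ θ} {g g' : θ ⟶ σ} (h : f ≫ g = f ≫ g') : g = g' := by
  refine PTreeHom.ext' (funext fun i => funext fun y => ?_)
  obtain ⟨a, rfl⟩ := PTreeHom.surj f i y
  rw [← comp_app, ← comp_app, h]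

theorem exists_fin_of_total {m : ℕ} (R : Fin m → Fin m → Prop) (htot : ∀ a b, R a b ∨ R b a)
    (htrans : ∀ a b c, R a b → R b c → R a c) :
    ∃ (t : ℕ) (w : Fin m → Fin t), Function.Surjective w ∧ ∀ a b, w a ≤ w b ↔ R a b := by
  let f : Fin m → ℕ := fun a => (Finset.univ.filter fun b => R b a).card
  have hf : ∀ a b, f a ≤ f b ↔ R a b := by
    intro a b
    constructor
    · intro h
      by_contra hab
      have hba := (htot a b).resolve_left hab
      refine absurd h (not_le.2 (Finset.card_lt_card ⟨fun c hc => ?_, fun hsub => ?_⟩))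
      · rw [Finset.mem_filter] at hc ⊢
        exact ⟨hc.1, htrans _ _ _ hc.2 hba⟩
      · have := hsub (Finset.mem_filter.2 ⟨Finset.mem_univ a, (htot a a).elim id id⟩)
        exact hab (Finset.mem_filter.1 this).2
    · intro h
      refine Finset.card_le_card fun c hc => ?_
      rw [Finset.mem_filter] at hc ⊢
      exact ⟨hc.1, htrans _ _ _ hc.2 h⟩
  let o := Finset.orderIsoOfFin (Finset.univ.image f) rfl
  have hmem : ∀ a, f a ∈ Finset.univ.image f := fun a =>
    Finset.mem_image_of_mem f (Finset.mem_univ a)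
  refine ⟨_, fun a => o.symm ⟨f a, hmem a⟩, fun y => ?_, fun a b => ?_⟩
  · obtain ⟨a, -, ha⟩ := Finset.mem_image.1 (o y).2
    refine ⟨a, ?_⟩
    rw [OrderIso.symm_apply_eq]
    exact Subtype.ext ha
  · rw [o.symm.le_iff_le, ← hf]
    exact Iff.rfl

/-- A system of total preorders on the levels of a tree, compatible with the structure maps,
defines a quotient tree. -/
theorem exists_quotient (τ : PTree n) (R : ∀ i, Fin (τ.t i) → Fin (τ.t i) → Prop)
    (htot : ∀ i a b, R i a b ∨ R i b a)
    (htrans : ∀ i a b c, R i a b → R i b c → R i a c)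
    (hpar : ∀ i a b, R i a b → R (i + 1) (τ.map i a) (τ.map i b))
    (hsib : ∀ i a b, τ.map i a = τ.map i b → a ≤ b → R i a b) :
    ∃ (θ : PTree n) (w : τ ⟶ θ), ∀ i a b,
      PTreeHom.app w i a ≤ PTreeHom.app w i b ↔ R i a b := by
  choose t w hsurj hw using fun i => exists_fin_of_total (R i) (htot i) (htrans i)
  have hle : ∀ i a b, w i a ≤ w i b → w (i + 1) (τ.map i a) ≤ w (i + 1) (τ.map i b) :=
    fun i a b h => (hw _ _ _).2 (hpar i a b ((hw _ _ _).1 h))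
  have hfac : ∀ i a, w (i + 1) (τ.map i (Function.surjInv (hsurj i) (w i a))) =
      w (i + 1) (τ.map i a) := by
    intro i a
    have e := Function.surjInv_eq (hsurj i) (w i a)
    exact le_antisymm (hle i _ _ e.le) (hle i _ _ e.ge)
  refine ⟨⟨t, fun i y => w (i + 1) (τ.map i (Function.surjInv (hsurj i) y)), ?_, ?_, ?_⟩,
    ⟨w, hsurj, fun i x => (hfac i x).symm, fun i x y h h' => (hw _ _ _).2 (hsib i x y h h')⟩,
    hw⟩
  · intro i y y' hy
    refine hle i _ _ ?_
    rwa [Function.surjInv_eq (hsurj i), Function.surjInv_eq (hsurj i)]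
  · intro i y
    obtain ⟨b, rfl⟩ := hsurj (i + 1) y
    obtain ⟨a, rfl⟩ := τ.surjmap i b
    exact ⟨w i a, hfac i a⟩
  · intro i hi
    have := τ.subsingleton_of_le hi
    have h1 : Subsingleton (Fin (t i)) := (hsurj i).subsingleton
    have h2 : Nonempty (Fin (t i)) := ⟨w i ⟨0, by rw [τ.top i hi]; exact one_pos⟩⟩
    have := Fintype.card_le_one_iff_subsingleton.2 h1
    have := Fintype.card_pos (α := Fin (t i))
    simp only [Fintype.card_fin] at *
    omega

end PTree

namespace PTree

variable {n : ℕ} {τ σ θ ρ : PTree n}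

/-- The parent of a vertex. -/
def parent (τ : PTree n) (a : Σ i, Fin (τ.t i)) : Σ i, Fin (τ.t i) := ⟨a.1 + 1, τ.map a.1 a.2⟩

theorem exists_of_parent_eq {a b : Σ i, Fin (τ.t i)} (h : τ.parent a = τ.parent b) :
    ∃ i x y, a = ⟨i, x⟩ ∧ b = ⟨i, y⟩ ∧ τ.map i x = τ.map i y := by
  obtain ⟨i, x⟩ := a
  obtain ⟨j, y⟩ := b
  obtain ⟨h1, h2⟩ := Sigma.mk.inj_iff.1 h
  obtain rfl : i = j := Nat.succ_injective h1
  exact ⟨i, x, y, rfl, rfl, eq_of_heq h2⟩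

theorem exists_tie_of_not_isIdentityHom {w : τ ⟶ θ} (h : ¬ IsIdentityHom w) :
    ∃ i a b, a ≠ b ∧ PTreeHom.app w i a = PTreeHom.app w i b := by
  by_contra hcon
  push Not at hcon
  exact h (isIdentityHom_of_injective fun i a b hab => by
    by_contra hne
    exact hcon i a b hne hab)

theorem intObj_ext {u : τ ⟶ σ} {x y : IntObj u} {z : x.1.1 ⟶ y.1.1}
    (hz : x.1.2.1 ≫ z = y.1.2.1) (h : IsIdentityHom z) : x = y := by
  obtain ⟨⟨θ, w, v⟩, hx, _, _⟩ := x
  obtain ⟨⟨θ', w', v'⟩, hy, _, _⟩ := y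
  obtain ⟨h1, h2⟩ := h
  simp only at h1 h2 hz z
  subst h1 h2
  rw [eqToHom_refl, Category.comp_id] at hz
  subst hz
  obtain rfl := hom_ext_of_comp (hx.trans hy.symm)
  rfl

theorem intRel_asymm {u : τ ⟶ σ} (x y : IntObj u) (hxy : IntRel x y) : ¬ IntRel y x := by
  rintro ⟨⟨z', hz'⟩, -⟩
  obtain ⟨⟨z, hz⟩, hne⟩ := hxy
  refine hne (intObj_ext hz (isIdentityHom_of_injective fun i => ?_))
  have h : z ≫ z' = 𝟙 _ := by
    apply hom_ext_of_comp (f := x.1.2.1)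
    rw [← Category.assoc, hz, hz', Category.comp_id]
  refine Function.Injective.of_comp (f := PTreeHom.app z' i) ?_
  have : PTreeHom.app z' i ∘ PTreeHom.app z i = _root_.id :=
    congrArg (fun f => PTreeHom.app f i) h
  rw [this]
  exact Function.injective_id

theorem intObj_app {u : τ ⟶ σ} (x : IntObj u) (i : ℕ) (a : Fin (τ.t i)) :
    PTreeHom.app x.1.2.2 i (PTreeHom.app x.1.2.1 i a) = PTreeHom.app u i a := by
  rw [← comp_app, x.2.1]

/-- The objects of the interval as strata described by the levels of the vertices of `τ`. -/
noncomputable def strata (u : τ ⟶ σ) : TreeStrata (IntObj u) (Σ i, Fin (τ.t i)) where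
  n := n
  r := IntRel
  lvl a := a.1
  par := τ.parent
  val a := a.2
  U a := PTreeHom.app u a.1 a.2
  W x a := PTreeHom.app x.1.2.1 a.1 a.2
  verts := (Finset.range n).sigma fun i => Finset.univ
  mem_verts a := by simp
  lvl_par a := rfl
  eq_of_top := by
    rintro ⟨i, a⟩ ⟨j, b⟩ h h'
    obtain rfl : i = j := h
    have := τ.subsingleton_of_le (i := i) h'
    rw [Subsingleton.elim a b]
  eq_of_val := by
    rintro ⟨i, a⟩ ⟨j, b⟩ h h'
    obtain rfl : i = j := h
    obtain rfl : a = b := Fin.ext h'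
    rfl
  par_mono := by
    rintro ⟨i, a⟩ ⟨j, b⟩ h h'
    obtain rfl : i = j := h
    exact τ.mono i h'
  exists_pred := by
    rintro ⟨i, b⟩ h
    have h : (b : ℕ) ≠ 0 := h
    exact ⟨⟨i, ⟨b - 1, by omega⟩⟩, rfl, show (b : ℕ) - 1 + 1 = b by omega⟩
  U_par := by
    rintro ⟨i, a⟩ ⟨j, b⟩ h h'
    obtain rfl : i = j := h
    simp only [parent, PTreeHom.comm u, Fin.ext h']
  U_mono a b h h' := by
    obtain ⟨i, x, y, rfl, rfl, hxy⟩ := exists_of_parent_eq h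
    exact PTreeHom.fiberMono u i x y hxy h'
  W_par x := by
    rintro ⟨i, a⟩ ⟨j, b⟩ h h'
    obtain rfl : i = j := h
    simp only [parent, PTreeHom.comm x.1.2.1]
    exact x.1.1.mono i h'
  U_le_of_W x := by
    rintro ⟨i, a⟩ ⟨j, b⟩ h h' h''
    obtain rfl : i = j := h
    have h1 := x.1.1.mono i (show PTreeHom.app x.1.2.1 i a ≤ PTreeHom.app x.1.2.1 i b from h')
    simp only [parent, PTreeHom.comm x.1.2.1] at h''
    have := PTreeHom.fiberMono x.1.2.2 i _ _ (le_antisymm h1 h'') h'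
    rw [intObj_app, intObj_app] at this
    exact this
  W_mono x a b h h' := by
    obtain ⟨i, y, z, rfl, rfl, hyz⟩ := exists_of_parent_eq h
    exact PTreeHom.fiberMono x.1.2.1 i y z hyz h'
  exists_tie x := by
    obtain ⟨i, a, b, hne, hab⟩ := exists_tie_of_not_isIdentityHom x.2.2.1
    exact ⟨⟨i, a⟩, ⟨i, b⟩, rfl, fun h => hne (eq_of_heq (Sigma.mk.inj_iff.1 h).2),
      congrArg Fin.val hab⟩
  exists_lt x := by
    obtain ⟨i, c, d, hne, hcd⟩ := exists_tie_of_not_isIdentityHom x.2.2.2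
    obtain ⟨a, rfl⟩ := PTreeHom.surj x.1.2.1 i c
    obtain ⟨b, rfl⟩ := PTreeHom.surj x.1.2.1 i d
    rw [intObj_app, intObj_app] at hcd
    rcases lt_or_gt_of_ne hne with h | h
    · exact ⟨⟨i, a⟩, ⟨i, b⟩, rfl, congrArg Fin.val hcd, h⟩
    · exact ⟨⟨i, b⟩, ⟨i, a⟩, rfl, congrArg Fin.val hcd.symm, h⟩
  r_asymm := intRel_asymm
  W_of_r x y hxy := by
    obtain ⟨⟨z, hz⟩, -⟩ := hxy
    rintro ⟨i, a⟩ ⟨j, b⟩ h h' h''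
    obtain rfl : i = j := h
    have h1 := x.1.1.mono i (show PTreeHom.app x.1.2.1 i a ≤ PTreeHom.app x.1.2.1 i b from h')
    simp only [parent, PTreeHom.comm x.1.2.1] at h''
    rw [← hz]
    exact PTreeHom.fiberMono z i _ _ (le_antisymm h1 h'') h'
  r_of_W x y hne h :=
    ⟨exists_comp_eq _ _ fun i a b h' h'' => h ⟨i, a⟩ ⟨i, b⟩ rfl h' h'', hne⟩
  realize R htot htrans hpar hsib hU htie hlt := by
    obtain ⟨θ, w, hw⟩ := τ.exists_quotient (fun i a b => R ⟨i, a⟩ ⟨i, b⟩)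
      (fun i a b => htot _ _ rfl) (fun i a b c => htrans _ _ _ rfl rfl)
      (fun i a b => hpar ⟨i, a⟩ ⟨i, b⟩ rfl)
      (fun i a b h h' => hsib ⟨i, a⟩ ⟨i, b⟩ (by simp only [parent, h]) h')
    obtain ⟨v, hv⟩ := exists_comp_eq w u fun i a b h h' =>
      hU ⟨i, a⟩ ⟨i, b⟩ rfl ((hw _ _ _).1 h) ((hw _ _ _).1 h')
    refine ⟨⟨⟨θ, w, v⟩, hv, fun hid => ?_, fun hid => ?_⟩, ?_⟩
    · obtain ⟨⟨i, a⟩, ⟨j, b⟩, h, hne, h1, h2⟩ := htie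
      obtain rfl : i = j := h
      have := injective_of_isIdentityHom hid i
        (le_antisymm ((hw _ _ _).2 h1) ((hw _ _ _).2 h2))
      exact hne (by rw [this])
    · obtain ⟨⟨i, a⟩, ⟨j, b⟩, h, hne, h1⟩ := hlt
      obtain rfl : i = j := h
      have h2 : PTreeHom.app u i a = PTreeHom.app u i b := Fin.ext hne
      rw [← hv, comp_app, comp_app] at h2
      exact h1 ((hw _ _ _).1 (injective_of_isIdentityHom hid i h2).ge)
    · rintro ⟨i, a⟩ ⟨j, b⟩ h
      obtain rfl : i = j := h
      exact hw i a b

theorem card_verts_strata (u : τ ⟶ σ) : (strata u).verts.card = τ.deg := by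
  simp [strata, deg, Finset.card_sigma]

theorem card_firsts {m t : ℕ} {f : Fin m → Fin t} (hf : Function.Surjective f) :
    (Finset.univ.filter fun b => ∀ a, a < b → f a ≠ f b).card = t := by
  refine Eq.trans ?_ (Finset.card_fin t)
  refine Finset.card_bij (fun b _ => f b) (fun _ _ => Finset.mem_univ _) ?_ ?_
  · intro a ha b hb hab
    rw [Finset.mem_filter] at ha hb
    rcases lt_trichotomy a b with h | h | h
    · exact absurd hab (hb.2 a h)
    · exact h
    · exact absurd hab.symm (ha.2 b h)
  · intro y _
    obtain ⟨b, hb, hmin⟩ := WellFounded.has_min (wellFounded_lt (α := Fin m))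
      {b | f b = y} (hf y)
    refine ⟨b, Finset.mem_filter.2 ⟨Finset.mem_univ b, fun a hab h => ?_⟩, hb⟩
    exact hmin a (h.trans hb) hab

theorem baseCard_strata (u : τ ⟶ σ) : (strata u).baseCard = σ.deg := by
  have : (strata u).reps (fun a b => (strata u).U a = (strata u).U b) =
      (Finset.range n).sigma fun i => Finset.univ.filter fun b =>
        ∀ a, a < b → PTreeHom.app u i a ≠ PTreeHom.app u i b := by
    ext ⟨i, b⟩
    rw [TreeStrata.mem_reps, Finset.mem_sigma, Finset.mem_range, Finset.mem_filter]
    refine and_congr_right fun _ => ⟨fun h => ⟨Finset.mem_univ _, fun a hab he => ?_⟩, ?_⟩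
    · exact h ⟨i, a⟩ rfl hab (congrArg Fin.val he)
    · rintro ⟨-, h⟩ ⟨j, a⟩ hij hab he
      obtain rfl : j = i := hij
      exact h a hab (Fin.ext he)
  rw [TreeStrata.baseCard, this, Finset.card_sigma, deg]
  exact Finset.sum_congr rfl fun i _ => card_firsts (PTreeHom.surj u i)

theorem isSpherical_intObj (k : Type) [CommRing k] (u : τ ⟶ σ) (e : ℕ)
    (hu : homDeg u = (e : ℤ) + 2) :
    OrderHomology.IsSpherical k (IntRel (u := u)) Set.univ (e + 1) := by
  refine (strata u).isSpherical_univ ?_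
  rw [card_verts_strata, baseCard_strata]
  simp only [homDeg] at hu
  omega

end PTree

namespace OrderHomology

theorem listBoundary_ofFn {V : Type*} (k : Type*) [CommRing k] {m : ℕ} (s : Fin (m + 1) → V) :
    listBoundary k (List.ofFn s) =
      ∑ i : Fin (m + 1), ((-1 : k) ^ (i : ℕ)) •
        Finsupp.single (List.ofFn (s ∘ i.succAbove)) (1 : k) := by
  induction m with
  | zero => simp [listBoundary]
  | succ m ih =>
    rw [List.ofFn_succ, listBoundary, ih, Fin.sum_univ_succ (n := m + 1), map_sum, sub_eq_add_neg,
      ← Finset.sum_neg_distrib]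
    congr 1
    · simp [Function.comp_def]
    · refine Finset.sum_congr rfl fun i _ => ?_
      rw [map_smul, consMap_single, List.ofFn_succ (f := s ∘ i.succ.succAbove)]
      simp [Function.comp_def, pow_succ]

variable {n : ℕ} {τ σ : PTree n} {u : τ ⟶ σ} (k : Type) [CommRing k]

/-- The list of vertices of a simplex. -/
def simpList {m : ℕ} (s : IntSimp u m) : List (IntObj u) := List.ofFn s.1

theorem simpList_injective {m : ℕ} : Function.Injective (simpList (u := u) (m := m)) :=
  fun _ _ h => Subtype.ext (List.ofFn_injective h)

/-- Simplicial chains as combinations of lists. -/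
noncomputable def toLists (m : ℕ) : (IntSimp u m →₀ k) →ₗ[k] (List (IntObj u) →₀ k) :=
  Finsupp.lmapDomain k k simpList

theorem toLists_injective (m : ℕ) : Function.Injective (toLists (u := u) k m) :=
  Finsupp.mapDomain_injective simpList_injective

@[simp]
theorem toLists_single {m : ℕ} (s : IntSimp u m) (a : k) :
    toLists k m (Finsupp.single s a) = Finsupp.single (simpList s) a := by
  simp [toLists]

theorem simpList_mem {m : ℕ} (s : IntSimp u m) :
    simpList s ∈ chainLists IntRel Set.univ ∩ {l : List (IntObj u) | l.length = m + 1} :=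
  ⟨⟨List.pairwise_ofFn.2 fun i j h => s.2 i j h, fun _ _ => Set.mem_univ _⟩, by simp [simpList]⟩

theorem range_simpList (m : ℕ) : Set.range (simpList (u := u) (m := m)) =
    chainLists IntRel Set.univ ∩ {l : List (IntObj u) | l.length = m + 1} := by
  refine Set.Subset.antisymm (Set.range_subset_iff.2 simpList_mem) ?_
  rintro l ⟨⟨hl, -⟩, hm⟩
  obtain ⟨m', s, rfl⟩ : ∃ m', ∃ s : Fin m' → IntObj u, l = List.ofFn s :=
    ⟨_, _, (List.ofFn_get l).symm⟩
  obtain rfl : m' = m + 1 := by simpa using hm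
  exact ⟨⟨s, fun i j h => List.pairwise_ofFn.1 hl h⟩, rfl⟩

theorem range_toLists (m : ℕ) : LinearMap.range (toLists (u := u) k m) =
    Finsupp.supported k k
      (chainLists IntRel Set.univ ∩ {l : List (IntObj u) | l.length = m + 1}) := by
  rw [← range_simpList, ← Set.image_univ, ← Finsupp.lmapDomain_supported, Finsupp.supported_univ,
    Submodule.map_top, toLists]

theorem exists_toLists_eq {m : ℕ} {x : List (IntObj u) →₀ k} (hx : x ∈ chains k IntRel Set.univ) :
    ∃ y : IntSimp u m →₀ k, toLists k m y = lengthPart k (m + 1) x := by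
  have := lengthPart_mem k (m := m + 1) hx
  rwa [← range_toLists] at this

theorem toLists_mem (m : ℕ) (x : IntSimp u m →₀ k) :
    toLists k m x ∈ chains k IntRel Set.univ ∧
      toLists k m x ∈ Finsupp.supported k k {l : List (IntObj u) | l.length = m + 1} := by
  have h : toLists k m x ∈ LinearMap.range (toLists (u := u) k m) := ⟨x, rfl⟩
  rw [range_toLists] at h
  exact ⟨Finsupp.supported_mono Set.inter_subset_left h,
    Finsupp.supported_mono Set.inter_subset_right h⟩

theorem toLists_intBFun {m : ℕ} (s : IntSimp u (m + 1)) :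
    toLists k m (intBFun k s) = listBoundary k (simpList s) := by
  refine Eq.trans ?_ (listBoundary_ofFn k s.1).symm
  rw [intBFun, map_sum]
  refine Finset.sum_congr rfl fun i _ => ?_
  exact (map_smul _ _ _).trans (congrArg _ (toLists_single k _ _))

theorem boundary_toLists {m : ℕ} (x : IntSimp u (m + 1) →₀ k) :
    boundary k (toLists k (m + 1) x) = toLists k m (intBdry k x) := by
  have h : intBdry k x = Finsupp.linearCombination k (intBFun k) x := rfl
  rw [h]
  induction x using Finsupp.induction_linear with
  | zero => simp
  | add x y hx hy => simp only [map_add, hx rfl, hy rfl]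
  | single s a =>
    rw [toLists_single, boundary_single, Finsupp.linearCombination_single, map_smul,
      toLists_intBFun]

theorem boundary_toLists_zero (x : IntSimp u 0 →₀ k) :
    boundary k (toLists k 0 x) = Finsupp.single [] (intAug k x) := by
  have h : intAug k x = Finsupp.linearCombination k (fun _ => (1 : k)) x := by
    simp [intAug, Finsupp.linearCombination_apply]
  rw [h]
  induction x using Finsupp.induction_linear with
  | zero => simp
  | add x y hx hy =>
    rw [map_add, map_add, map_add, Finsupp.single_add]
    rw [hx (by simp [intAug, Finsupp.linearCombination_apply]),
      hy (by simp [intAug, Finsupp.linearCombination_apply])]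
  | single s a =>
    rw [toLists_single, boundary_single, simpList, listBoundary_ofFn]
    simp

theorem intIsCyc_iff {m : ℕ} (x : IntSimp u m →₀ k) :
    intIsCyc k m x ↔ boundary k (toLists k m x) = 0 := by
  cases m with
  | zero => rw [boundary_toLists_zero, Finsupp.single_eq_zero]; rfl
  | succ m =>
    rw [boundary_toLists, (toLists k m).map_eq_zero_iff (toLists_injective k m)]
    rfl

end OrderHomology

open OrderHomology

/-- STATEMENT 9: for a morphism `u : τ ⟶ σ` of degree `d = e + 2 ≥ 2`, the
order complex of the open interval between `α = (τ, id)` and `β = (σ, u_0)`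
in the poset `E/Ω_n^epi` has reduced homology (with coefficients in `k`)
equal to `k` in dimension `d - 2 = e` and `0` in all other dimensions
(including dimension `-1`: the augmentation is surjective). -/
theorem stmt_9 (n : ℕ) (hn : 1 ≤ n) (k : Type) [CommRing k]
    {τ σ : PTree n} (u : τ ⟶ σ) (e : ℕ) (hu : homDeg u = (e : ℤ) + 2) :
    Function.Surjective (intAug (u := u) k) ∧
    (∀ (m : ℕ) (x : IntSimp u m →₀ k), m ≠ e → intIsCyc k m x →
      ∃ y : IntSimp u (m + 1) →₀ k, intBdry k y = x) ∧
    (∃ z : IntSimp u e →₀ k, intIsCyc k e z ∧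
      ∀ x : IntSimp u e →₀ k, intIsCyc k e x →
        ∃! a : k, ∃ y : IntSimp u (e + 1) →₀ k,
          x = a • z + intBdry k y) := by
  obtain ⟨z, hz, hzlen, hz0, hgen, hinj⟩ := PTree.isSpherical_intObj k u e hu
  have hker : ∀ (m : ℕ) (x : IntSimp u m →₀ k), intIsCyc k m x →
      ∃ (a : k) (y : IntSimp u (m + 1) →₀ k),
        toLists k m x = a • lengthPart k (m + 1) z + toLists k m (intBdry k y) := by
    intro m x hx
    rw [intIsCyc_iff] at hx
    obtain ⟨hx1, hx2⟩ := toLists_mem k m x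
    obtain ⟨a, y, hy, hxy⟩ := hgen _ hx1 hx
    obtain ⟨y', hy'⟩ := exists_toLists_eq k (m := m + 1) hy
    refine ⟨a, y', ?_⟩
    rw [← boundary_toLists, hy', ← lengthPart_boundary, ← lengthPart_smul, ← lengthPart_add,
      ← hxy, lengthPart_of_mem k hx2]
  refine ⟨fun b => ?_, fun m x hm hx => ?_, ?_⟩
  · obtain ⟨a, y, hy, hxy⟩ := hgen (Finsupp.single [] b)
      (Finsupp.single_mem_supported k _ ⟨List.Pairwise.nil, fun _ _ => Set.mem_univ _⟩)
      (by simp [listBoundary])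
    obtain ⟨y', hy'⟩ := exists_toLists_eq k (m := 0) hy
    refine ⟨y', ?_⟩
    have h := congrArg (lengthPart k 0) hxy
    rw [lengthPart_add, lengthPart_smul, lengthPart_of_mem_ne k (Nat.succ_ne_zero e) hzlen,
      smul_zero, zero_add, lengthPart_boundary, ← hy', boundary_toLists_zero,
      lengthPart_of_mem k (m := 0) (Finsupp.single_mem_supported k _ rfl)] at h
    exact (Finsupp.single_injective _ h).symm
  · obtain ⟨a, y, hxy⟩ := hker m x hx
    rw [lengthPart_of_mem_ne k (by omega) hzlen, smul_zero, zero_add] at hxy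
    exact ⟨y, (toLists_injective k m hxy).symm⟩
  · obtain ⟨w, hw⟩ := exists_toLists_eq k (m := e) hz
    rw [lengthPart_of_mem k hzlen] at hw
    refine ⟨w, (intIsCyc_iff k w).2 (by rw [hw, hz0]), fun x hx => ?_⟩
    obtain ⟨a, y, hxy⟩ := hker e x hx
    rw [lengthPart_of_mem k hzlen, ← hw, ← map_smul, ← map_add] at hxy
    refine ⟨a, ⟨y, toLists_injective k e hxy⟩, ?_⟩
    rintro b ⟨y', hy'⟩
    have h := hxy
    rw [hy', map_add, map_add, map_smul, map_smul, hw, ← boundary_toLists,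
      ← boundary_toLists] at h
    refine sub_eq_zero.1 (hinj _ (toLists k (e + 1) y - toLists k (e + 1) y')
      (sub_mem (toLists_mem k _ _).1 (toLists_mem k _ _).1) ?_)
    rw [map_sub, sub_smul, sub_eq_sub_iff_add_eq_add, h, add_comm]
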